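/- arXiv:1710.05537 — 9 statements merged into one kernel-verified Lean document; each statement's English description precedes it below -/
import Mathlib

section
/- For all indices 1 ≤ s ≤ t ≤ n, the Euclidean inner product of the vectors A_s and A_t in ℝ^{n+1} equals (R²/S)·(−X_s·X_t + s·S). -/
theorem sum_fin_add_two_eq_sum_Icc (n : ℕ) (f : ℕ → ℝ) :
    ∑ i : Fin n, f ((i : ℕ) + 2) = ∑ i ∈ Finset.Icc 2 (n + 1), f i := by
  induction n with
  | zero => simp
  | succ n ih =>
    rw [Fin.sum_univ_castSucc, Finset.sum_Icc_succ_top (by omega)]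
    simp [ih]

theorem sum_Icc_indicator_mul {m k N : ℕ} (h : m ≤ k) (f : ℕ → ℝ) :
    ∑ i ∈ Finset.Icc m N, (if k ≤ i then 1 else 0) * f i = ∑ i ∈ Finset.Icc k N, f i := by
  simp only [ite_mul, one_mul, zero_mul]
  rw [← Finset.sum_filter]
  congr 1
  ext i
  simp only [Finset.mem_filter, Finset.mem_Icc]
  omega

/-- For all indices `1 ≤ s ≤ t ≤ n`, the Euclidean inner product of the
vectors `A s` and `A t` in `ℝ^{n+1}` equals `(R²/S)·(−X_s·X_t + s·S)`. -/
theorem gram_entry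
    (n : ℕ) (hn : 1 ≤ n)
    (a : ℕ → ℕ) (ha1 : a 1 = 0)
    (hapos : ∀ i, 2 ≤ i → i ≤ n + 1 → 0 < a i)
    (R : ℝ) (hR : 0 < R)
    (S : ℝ) (hS : S = 1 + ∑ i ∈ Finset.Icc 2 (n + 1), (a i : ℝ) ^ 2)
    (X : ℕ → ℝ) (hX : ∀ s, X s = ∑ i ∈ Finset.Icc (n + 2 - s) (n + 1), (a i : ℝ))
    (A : ℕ → Fin (n + 1) → ℝ)
    (hA : ∀ s, 1 ≤ s → s ≤ n → ∀ j : Fin (n + 1),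
      A s j =
        if (j : ℕ) + 1 = 1 then R / S * (-X s)
        else if (j : ℕ) + 1 ≤ n + 1 - s then R / S * (-(a ((j : ℕ) + 1) : ℝ) * X s)
        else R / S * (S - (a ((j : ℕ) + 1) : ℝ) * X s)) :
    ∀ s t : ℕ, 1 ≤ s → s ≤ t → t ≤ n →
      ∑ j : Fin (n + 1), A s j * A t j = R ^ 2 / S * (-(X s * X t) + (s : ℝ) * S) := by
  intro s t hs hst ht
  have hS0 : S ≠ 0 := by
    have : 0 ≤ ∑ i ∈ Finset.Icc 2 (n + 1), (a i : ℝ) ^ 2 :=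
      Finset.sum_nonneg fun i _ => sq_nonneg _
    linarith
  set e : ℕ → ℕ → ℝ := fun u i => if n + 2 - u ≤ i then 1 else 0 with he
  have hA0 : ∀ u, 1 ≤ u → u ≤ n → A u 0 = R / S * (-X u) := fun u h1 h2 => by
    simp [hA u h1 h2]
  have hAsucc : ∀ u, 1 ≤ u → u ≤ n → ∀ i : Fin n,
      A u i.succ = R / S * (S * e u ((i : ℕ) + 2) - a ((i : ℕ) + 2) * X u) := by
    intro u h1 h2 i
    rw [hA u h1 h2, if_neg (by simp)]
    simp only [Fin.val_succ, he]
    by_cases h : (i : ℕ) + 1 + 1 ≤ n + 1 - u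
    · rw [if_pos h, if_neg (by omega)]
      ring
    · rw [if_neg h, if_pos (by omega)]
      ring
  have hea : ∀ u, u ≤ n → ∑ i ∈ Finset.Icc 2 (n + 1), e u i * (a i : ℝ) = X u := by
    intro u hu
    rw [hX u]
    exact sum_Icc_indicator_mul (by omega) fun i => (a i : ℝ)
  have hee : ∑ i ∈ Finset.Icc 2 (n + 1), e s i * e t i = s := by
    refine (sum_Icc_indicator_mul (by omega) (e t)).trans ?_
    rw [Finset.sum_congr rfl (g := fun _ => (1 : ℝ))]
    · have : n + 1 + 1 - (n + 2 - s) = s := by omega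
      simp [this]
    · intro i hi
      rw [Finset.mem_Icc] at hi
      exact if_pos (by omega)
  have hsum : ∑ i ∈ Finset.Icc 2 (n + 1),
      (R / S * (S * e s i - a i * X s)) * (R / S * (S * e t i - a i * X t)) =
      (R / S) ^ 2 * (S ^ 2 * s - S * X t * X s - S * X s * X t + X s * X t * (S - 1)) := by
    have hsq : S - 1 = ∑ i ∈ Finset.Icc 2 (n + 1), (a i : ℝ) ^ 2 := by linarith
    calc
      _ = (R / S) ^ 2 * (S ^ 2 * ∑ i ∈ Finset.Icc 2 (n + 1), e s i * e t i
          - S * X t * ∑ i ∈ Finset.Icc 2 (n + 1), e s i * (a i : ℝ)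
          - S * X s * ∑ i ∈ Finset.Icc 2 (n + 1), e t i * (a i : ℝ)
          + X s * X t * ∑ i ∈ Finset.Icc 2 (n + 1), (a i : ℝ) ^ 2) := by
        simp only [Finset.mul_sum, ← Finset.sum_sub_distrib, ← Finset.sum_add_distrib]
        exact Finset.sum_congr rfl fun i _ => by ring
      _ = _ := by rw [hee, hea s (by omega), hea t ht, hsq]
  rw [Fin.sum_univ_succ, hA0 s hs (by omega), hA0 t (by omega) ht]
  simp only [hAsucc s hs (by omega), hAsucc t (by omega) ht]
  rw [sum_fin_add_two_eq_sum_Icc n fun i =>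
    (R / S * (S * e s i - a i * X s)) * (R / S * (S * e t i - a i * X t)), hsum]
  field_simp
  ring
end

section
/- The Gram matrix 𝔸 := (⟨A_s, A_t⟩)_{1≤s,t≤n} satisfies 𝔸 · (B/R²) = I_n, the n×n identity matrix; in particular 𝔸 is invertible with inverse (1/R²)·B, and the vectors A_1, …, A_n are linearly independent. -/
/-- If two families `D`, `A` of vectors are orthogonal to a vector `v` of square length `S ≠ 0`,
biorthogonal up to the factor `R`, and together with `v` have as many members as the dimension,
then their Gram matrices are inverse to each other up to the factor `R ^ 2`. -/
theorem gram_mul_gram_of_biorthogonal {n : ℕ} {R S : ℝ} (hR : R ≠ 0) (hS : S ≠ 0)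
    (A D : Matrix (Fin n) (Fin (n + 1)) ℝ) (v : Matrix Unit (Fin (n + 1)) ℝ)
    (hDA : D * A.transpose = R • 1) (hDv : D * v.transpose = 0) (hAv : A * v.transpose = 0)
    (hvv : v * v.transpose = S • 1) :
    (A * A.transpose) * (D * D.transpose) = R ^ 2 • 1 := by
  have hvA : v * A.transpose = 0 := by
    simpa using congrArg Matrix.transpose hAv
  have hvD : v * D.transpose = 0 := by
    simpa using congrArg Matrix.transpose hDv
  have hAD : A * D.transpose = R • 1 := by
    simpa using congrArg Matrix.transpose hDA
  have hrows : Matrix.fromRows (R⁻¹ • D) (S⁻¹ • v) *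
      Matrix.fromCols A.transpose v.transpose = 1 := by
    rw [Matrix.fromRows_mul_fromCols]
    simp [hDA, hDv, hvA, hvv, smul_smul, hR, hS]
  have hcols : Matrix.fromCols A.transpose v.transpose *
      Matrix.fromRows (R⁻¹ • D) (S⁻¹ • v) = 1 :=
    (Matrix.mul_eq_one_comm_of_card_eq _ _ _ (by simp)).1 hrows
  rw [Matrix.fromCols_mul_fromRows] at hcols
  have hres : A.transpose * (R⁻¹ • D) * D.transpose = D.transpose := by
    have h := congrArg (· * D.transpose) hcols
    simpa [Matrix.add_mul, Matrix.mul_assoc, hvD] using h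
  have hres' : A.transpose * D * D.transpose = R • D.transpose := by
    conv_rhs => rw [← hres]
    simp [smul_smul, hR]
  calc (A * A.transpose) * (D * D.transpose)
      = A * (A.transpose * D * D.transpose) := by simp only [Matrix.mul_assoc]
    _ = R ^ 2 • 1 := by rw [hres', Matrix.mul_smul, hAD, smul_smul, sq]

/-- Reindexing of a sum over `Fin m` as a sum over `{1, …, m}`. -/
theorem sum_fin_succ_eq_sum_Icc (m : ℕ) (f : ℕ → ℝ) :
    ∑ j : Fin m, f ((j : ℕ) + 1) = ∑ i ∈ Finset.Icc 1 m, f i := by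
  rw [Fin.sum_univ_eq_sum_range (fun j => f (j + 1)), Finset.range_eq_Ico,
    Finset.sum_Ico_add' f 0 m 1]
  rfl

/-- The Gram matrix `𝔸 := (⟨A_s, A_t⟩)` satisfies `𝔸 · (B/R²) = I`, so `𝔸` is
invertible with inverse `(1/R²)·B`, and the vectors `A_1, …, A_n` are linearly independent. -/
theorem gram_inverse
    (n : ℕ) (hn : 1 ≤ n)
    (a : ℕ → ℕ) (ha1 : a 1 = 0)
    (hapos : ∀ i, 2 ≤ i → i ≤ n + 1 → 0 < a i)
    (R : ℝ) (hR : 0 < R)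
    (S : ℝ) (hS : S = 1 + ∑ i ∈ Finset.Icc 2 (n + 1), (a i : ℝ) ^ 2)
    (X : ℕ → ℝ) (hX : ∀ s, X s = ∑ i ∈ Finset.Icc (n + 2 - s) (n + 1), (a i : ℝ))
    (N : ℕ → ℝ) (hN : ∀ s, 1 ≤ s → s ≤ n → N s = (a (n + 1 - s) : ℝ) - (a (n + 2 - s) : ℝ))
    (A : ℕ → Fin (n + 1) → ℝ)
    (hA : ∀ s, 1 ≤ s → s ≤ n → ∀ j : Fin (n + 1),
      A s j =
        if (j : ℕ) + 1 = 1 then R / S * (-X s)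
        else if (j : ℕ) + 1 ≤ n + 1 - s then R / S * (-(a ((j : ℕ) + 1) : ℝ) * X s)
        else R / S * (S - (a ((j : ℕ) + 1) : ℝ) * X s))
    (Am : Matrix (Fin n) (Fin n) ℝ)
    (hAm : ∀ s t : Fin n, Am s t = ∑ j : Fin (n + 1), A ((s : ℕ) + 1) j * A ((t : ℕ) + 1) j)
    (Bm : Matrix (Fin n) (Fin n) ℝ)
    (hBm : ∀ s t : Fin n, Bm s t =
      if (s : ℕ) + 1 = (t : ℕ) + 1 then
        (if (s : ℕ) + 1 = n then 1 + N n ^ 2 else 2 + N ((s : ℕ) + 1) ^ 2)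
      else if (t : ℕ) + 1 = (s : ℕ) + 1 + 1 ∨ (s : ℕ) + 1 = (t : ℕ) + 1 + 1 then
        -1 + N ((s : ℕ) + 1) * N ((t : ℕ) + 1)
      else N ((s : ℕ) + 1) * N ((t : ℕ) + 1)) :
    Am * ((R ^ 2)⁻¹ • Bm) = 1 ∧ IsUnit Am ∧ Am⁻¹ = (R ^ 2)⁻¹ • Bm ∧
      LinearIndependent ℝ (fun s : Fin n => A ((s : ℕ) + 1)) := by
  have hSpos : 0 < S := by rw [hS]; positivity
  have hR0 := hR.ne'
  have hS0 := hSpos.ne'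
  let w : Fin n → ℝ := fun s => N ((s : ℕ) + 1) + if (s : ℕ) + 1 = n then 1 else 0
  let D : Matrix (Fin n) (Fin (n + 1)) ℝ := Matrix.of fun s j =>
    (if (j : ℕ) = n - s then 1 else 0) - (if (j : ℕ) = n - 1 - s then 1 else 0)
      + (if (j : ℕ) = 0 then w s else 0)
  let V : Fin (n + 1) → ℝ := fun j => if (j : ℕ) = 0 then 1 else a ((j : ℕ) + 1)
  let v : Matrix Unit (Fin (n + 1)) ℝ := Matrix.of fun _ => V
  let A' : Matrix (Fin n) (Fin (n + 1)) ℝ := Matrix.of fun s => A ((s : ℕ) + 1)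
  have hp (s : Fin n) : n - (s : ℕ) < n + 1 := by omega
  have hq (s : Fin n) : n - 1 - (s : ℕ) < n + 1 := by omega
  have hD (s : Fin n) (f : Fin (n + 1) → ℝ) : ∑ j, D s j * f j =
      f ⟨n - s, hp s⟩ - f ⟨n - 1 - s, hq s⟩ + w s * f 0 := by
    have e1 (j : Fin (n + 1)) : (j : ℕ) = n - s ↔ j = ⟨n - s, hp s⟩ := by
      rw [Fin.ext_iff]
    have e2 (j : Fin (n + 1)) : (j : ℕ) = n - 1 - s ↔ j = ⟨n - 1 - s, hq s⟩ := by
      rw [Fin.ext_iff]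
    have e3 (j : Fin (n + 1)) : (j : ℕ) = 0 ↔ j = 0 := by
      rw [Fin.ext_iff]; rfl
    simp only [D, Matrix.of_apply, e1, e2, e3, add_mul, sub_mul, Finset.sum_add_distrib,
      Finset.sum_sub_distrib, ite_mul, one_mul, zero_mul, Finset.sum_ite_eq', Finset.mem_univ,
      if_true]
  have hAV (t : Fin n) (j : Fin (n + 1)) : A ((t : ℕ) + 1) j =
      R * (if n ≤ (j : ℕ) + t then 1 else 0) - R / S * X ((t : ℕ) + 1) * V j := by
    rw [hA _ (by omega) (by omega)]
    have ht := t.2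
    simp only [V]
    split_ifs <;> first | omega | (field_simp; try ring)
  have hDV (s : Fin n) : ∑ j, D s j * V j = 0 := by
    rw [hD]
    have hs := s.2
    simp only [V, w]
    rw [hN _ (by omega) (by omega)]
    have e1 : n + 1 - ((s : ℕ) + 1) = n - 1 - s + 1 := by omega
    have e2 : n + 2 - ((s : ℕ) + 1) = n - s + 1 := by omega
    rw [e1, e2]
    by_cases h : (s : ℕ) + 1 = n
    · have e3 : n - 1 - (s : ℕ) = 0 := by omega
      have e4 : n - (s : ℕ) = 1 := by omega
      simp [h, e3, e4, ha1]
    · have e3 : n - 1 - (s : ℕ) ≠ 0 := by omega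
      have e4 : n - (s : ℕ) ≠ 0 := by omega
      simp [h, e3, e4]
  have hVV : ∑ j, V j * V j = S := by
    have h := sum_fin_succ_eq_sum_Icc (n + 1)
      (fun i => if i = 1 then (1 : ℝ) else (a i : ℝ) ^ 2)
    rw [← Finset.add_sum_Ioc_eq_sum_Icc (by omega)] at h
    rw [hS]
    convert h using 1
    · refine Finset.sum_congr rfl fun j _ => ?_
      simp only [V]
      split_ifs <;> first | omega | ring
    · simp only [if_true]
      congr 1
      refine Finset.sum_congr rfl fun i hi => ?_
      have := (Finset.mem_Icc.1 hi).1
      rw [if_neg (by omega)]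
  have hEV (t : Fin n) : ∑ j : Fin (n + 1), (if n ≤ (j : ℕ) + t then 1 else 0) * V j =
      X ((t : ℕ) + 1) := by
    have h := sum_fin_succ_eq_sum_Icc (n + 1)
      (fun i => if n + 1 ≤ i + t then (a i : ℝ) else 0)
    rw [← Finset.sum_filter (s := Finset.Icc 1 (n + 1))] at h
    rw [hX]
    have ht := t.2
    convert h using 1
    · refine Finset.sum_congr rfl fun j _ => ?_
      simp only [V]
      split_ifs <;> first | omega | simp
    · congr 1
      ext i
      simp only [Finset.mem_Icc, Finset.mem_filter]
      omega
  have hAv (t : Fin n) : ∑ j, A ((t : ℕ) + 1) j * V j = 0 := by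
    simp only [hAV, sub_mul, mul_assoc, Finset.sum_sub_distrib, ← Finset.mul_sum]
    rw [hVV, hEV]
    field_simp
    ring
  have hDA (s t : Fin n) : ∑ j, D s j * A ((t : ℕ) + 1) j = if s = t then R else 0 := by
    have e : ∑ j, D s j * A ((t : ℕ) + 1) j =
        R * ∑ j : Fin (n + 1), D s j * (if n ≤ (j : ℕ) + t then 1 else 0)
          - R / S * X ((t : ℕ) + 1) * ∑ j, D s j * V j := by
      rw [Finset.mul_sum, Finset.mul_sum, ← Finset.sum_sub_distrib]
      refine Finset.sum_congr rfl fun j _ => ?_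
      rw [hAV]
      ring
    rw [e, hDV, hD]
    have hs := s.2
    have ht := t.2
    have c1 : n ≤ n - (s : ℕ) + t ↔ (s : ℕ) ≤ t := by omega
    have c2 : n ≤ n - 1 - (s : ℕ) + t ↔ (s : ℕ) < t := by omega
    have c3 : ¬ n ≤ (t : ℕ) := by omega
    simp only [Fin.val_zero, zero_add, c1, c2, c3, if_false, Fin.ext_iff]
    rcases lt_trichotomy (s : ℕ) t with h | h | h
    · simp [h, h.le, h.ne]
    · simp [h]
    · simp [h.not_ge, h.not_gt, h.ne']
  have hDD (s t : Fin n) : ∑ j, D s j * D t j = Bm s t := by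
    rw [hD, hBm]
    have hs := s.2
    have ht := t.2
    simp only [D, w, Matrix.of_apply, Fin.val_zero]
    have c1 : n - (s : ℕ) = n - t ↔ (s : ℕ) = t := by omega
    have c2 : n - (s : ℕ) = n - 1 - t ↔ (s : ℕ) = t + 1 := by omega
    have c3 : ¬ n - (s : ℕ) = 0 := by omega
    have c4 : n - 1 - (s : ℕ) = n - t ↔ (t : ℕ) = s + 1 := by omega
    have c5 : n - 1 - (s : ℕ) = n - 1 - t ↔ (s : ℕ) = t := by omega
    have c6 : n - 1 - (s : ℕ) = 0 ↔ (s : ℕ) + 1 = n := by omega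
    have c7 : ¬ 0 = n - (t : ℕ) := by omega
    have c8 : 0 = n - 1 - (t : ℕ) ↔ (t : ℕ) + 1 = n := by omega
    simp only [c1, c2, c3, c4, c5, c6, c7, c8, if_false, if_true, add_left_inj]
    by_cases hst : (s : ℕ) = t
    · rw [← hst]
      by_cases hsn : (s : ℕ) + 1 = n
      · have hsn' : (s : ℕ) ≠ n := hs.ne
        simp [hsn, hsn']
        ring
      · simp [hsn]
        ring
    · split_ifs <;> first | omega | ring
  have hAmEq : Am = A' * A'.transpose := by
    ext s t
    rw [hAm]
    rfl
  have hBmEq : Bm = D * D.transpose := by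
    ext s t
    rw [← hDD]
    rfl
  have hmul : Am * ((R ^ 2)⁻¹ • Bm) = 1 := by
    have h := gram_mul_gram_of_biorthogonal hR0 hS0 A' D v
      (by ext s t; simpa [Matrix.one_apply, Matrix.mul_apply, A'] using hDA s t)
      (by ext s t; exact hDV s)
      (by ext s t; exact hAv s)
      (by ext s t; simpa [Matrix.one_apply, Matrix.mul_apply, v] using hVV)
    rw [Matrix.mul_smul, hAmEq, hBmEq, h, smul_smul, inv_mul_cancel₀ (pow_ne_zero 2 hR0), one_smul]
  refine ⟨hmul, IsUnit.of_mul_eq_one _ hmul, Matrix.inv_eq_right_inv hmul, ?_⟩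
  rw [Fintype.linearIndependent_iff]
  intro c hc s
  have h : ∑ j, D s j * (∑ t, c t • A ((t : ℕ) + 1)) j = c s * R := by
    simp only [Finset.sum_apply, Pi.smul_apply, smul_eq_mul, Finset.mul_sum]
    rw [Finset.sum_comm]
    simp only [mul_left_comm _ (c _), ← Finset.mul_sum, hDA]
    simp
  rw [hc] at h
  simpa [hR0] using h.symm
end

section
/- Each vector A_s (1 ≤ s ≤ n) lies in the hyperplane Π = {x ∈ ℝ^{n+1} : x¹ + ∑_{i=2}^{n+1} a_i x^i = 0}, and the family (A_1, …, A_n) is linearly independent; hence it is a basis of the n-dimensional subspace Π of ℝ^{n+1}. -/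
/-- A family of vectors is linearly independent if it admits a family of functionals that is
biorthogonal to it up to a nonzero scalar. -/
lemma linearIndependent_of_biorthogonal {ι M : Type*} [Fintype ι] [DecidableEq ι]
    [AddCommGroup M] [Module ℝ M] (v : ι → M) (f : ι → M →ₗ[ℝ] ℝ) {r : ℝ} (hr : r ≠ 0)
    (h : ∀ t s, f t (v s) = if s = t then r else 0) : LinearIndependent ℝ v := by
  rw [Fintype.linearIndependent_iff]
  intro c hc t
  have ht := congrArg (f t) hc
  simpa [h, hr] using ht

/-- `n` linearly independent vectors in a proper subspace of an `(n + 1)`-dimensional space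
span that subspace. -/
lemma span_eq_and_finrank_eq_of_ne_top {n : ℕ} {P : Submodule ℝ (Fin (n + 1) → ℝ)}
    (hP : P ≠ ⊤) {v : Fin n → Fin (n + 1) → ℝ} (hv : LinearIndependent ℝ v)
    (hmem : ∀ s, v s ∈ P) :
    Submodule.span ℝ (Set.range v) = P ∧ Module.finrank ℝ P = n := by
  have hle : Submodule.span ℝ (Set.range v) ≤ P :=
    Submodule.span_le.2 (Set.range_subset_iff.2 hmem)
  have hspan : Module.finrank ℝ (Submodule.span ℝ (Set.range v)) = n := by
    simpa using finrank_span_eq_card hv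
  have hlt : Module.finrank ℝ P < n + 1 := by
    simpa using Submodule.finrank_lt hP
  have hge := Submodule.finrank_mono hle
  have hfin : Module.finrank ℝ P = n := by omega
  exact ⟨Submodule.eq_of_le_of_finrank_eq hle (hspan.trans hfin.symm), hfin⟩

/-- The sum of `f (j + 1)` over the last `s` indices `j` of `Fin (n + 1)`. -/
lemma sum_fin_ite_le (n s : ℕ) (f : ℕ → ℝ) (hs : s ≤ n) :
    ∑ j : Fin (n + 1), (if n + 1 - s ≤ (j : ℕ) then f (j + 1) else 0) =
      ∑ i ∈ Finset.Icc (n + 2 - s) (n + 1), f i := by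
  rw [Fin.sum_univ_eq_sum_range (fun j => if n + 1 - s ≤ j then f (j + 1) else 0),
    ← Finset.sum_filter]
  refine Finset.sum_bij (fun j _ => j + 1) ?_ ?_ ?_ ?_
  · intro j hj
    simp only [Finset.mem_filter, Finset.mem_range, Finset.mem_Icc] at hj ⊢
    omega
  · intro i _ j _ hij
    omega
  · intro i hi
    simp only [Finset.mem_Icc] at hi
    refine ⟨i - 1, ?_, by omega⟩
    simp only [Finset.mem_filter, Finset.mem_range]
    omega
  · intro j _
    rfl

/-- Each vector `A_s` (`1 ≤ s ≤ n`) lies in the hyperplane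
`Π = {x : x¹ + ∑_{i=2}^{n+1} a_i x^i = 0}`, and the family `(A_1, …, A_n)` is linearly
independent; hence it is a basis of the `n`-dimensional subspace `Π` of `ℝ^{n+1}`. -/
theorem A_basis_of_hyperplane
    (n : ℕ) (hn : 1 ≤ n)
    (a : ℕ → ℕ)
    (hapos : ∀ i, 2 ≤ i → i ≤ n + 1 → 0 < a i)
    (R : ℝ) (hR : 0 < R)
    (S : ℝ) (hS : S = 1 + ∑ i ∈ Finset.Icc 2 (n + 1), (a i : ℝ) ^ 2)
    (X : ℕ → ℝ) (hX : ∀ s, X s = ∑ i ∈ Finset.Icc (n + 2 - s) (n + 1), (a i : ℝ))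
    (A : ℕ → Fin (n + 1) → ℝ)
    (hA : ∀ s, 1 ≤ s → s ≤ n → ∀ j : Fin (n + 1),
      A s j =
        if (j : ℕ) + 1 = 1 then R / S * (-X s)
        else if (j : ℕ) + 1 ≤ n + 1 - s then R / S * (-(a ((j : ℕ) + 1) : ℝ) * X s)
        else R / S * (S - (a ((j : ℕ) + 1) : ℝ) * X s))
    (Pi : Submodule ℝ (Fin (n + 1) → ℝ))
    (hPi : ∀ x : Fin (n + 1) → ℝ, x ∈ Pi ↔
      ∑ j : Fin (n + 1), (if (j : ℕ) = 0 then (1 : ℝ) else (a ((j : ℕ) + 1) : ℝ)) * x j = 0) :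
    (∀ s, 1 ≤ s → s ≤ n → A s ∈ Pi) ∧
      LinearIndependent ℝ (fun s : Fin n => A ((s : ℕ) + 1)) ∧
      Submodule.span ℝ (Set.range fun s : Fin n => A ((s : ℕ) + 1)) = Pi ∧
      Module.finrank ℝ Pi = n := by
  set w : Fin (n + 1) → ℝ := fun j => if (j : ℕ) = 0 then 1 else (a (j + 1) : ℝ) with hw
  have hSpos : 0 < S := by
    rw [hS]
    positivity
  have hw0 : w 0 = 1 := by simp [hw]
  have hwsq : ∑ j, w j ^ 2 = S := by
    have h := sum_fin_ite_le n n (fun i => (a i : ℝ) ^ 2) le_rfl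
    rw [Nat.add_sub_cancel_left, Nat.add_sub_cancel_left] at h
    rw [hS, ← h, Fin.sum_univ_succ, Fin.sum_univ_succ]
    simp [hw]
  have hwX : ∀ s, s ≤ n → ∑ j : Fin (n + 1), (if n + 1 - s ≤ (j : ℕ) then w j else 0) = X s := by
    intro s hs
    rw [hX, ← sum_fin_ite_le n s (fun i => (a i : ℝ)) hs]
    refine Finset.sum_congr rfl fun j _ => ?_
    split_ifs with hj
    · exact if_neg (by omega)
    · rfl
  have hAw : ∀ s, 1 ≤ s → s ≤ n → ∀ j,
      A s j = R / S * (S * (if n + 1 - s ≤ (j : ℕ) then 1 else 0) - X s * w j) := by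
    intro s hs hsn j
    rw [hA s hs hsn]
    simp only [hw]
    split_ifs <;> first | omega | ring
  have hmem : ∀ s, 1 ≤ s → s ≤ n → A s ∈ Pi := by
    intro s hs hsn
    rw [hPi]
    calc ∑ j, w j * A s j
        = R / S * (S * ∑ j : Fin (n + 1), (if n + 1 - s ≤ (j : ℕ) then w j else 0)
            - X s * ∑ j, w j ^ 2) := by
          rw [Finset.mul_sum, Finset.mul_sum, ← Finset.sum_sub_distrib, Finset.mul_sum]
          refine Finset.sum_congr rfl fun j _ => ?_
          rw [hAw s hs hsn]
          split_ifs <;> ring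
      _ = 0 := by rw [hwX s hsn, hwsq]; ring
  have hstep : ∀ s, 1 ≤ s → s ≤ n → ∀ j,
      A s j - w j * A s 0 = if n + 1 - s ≤ (j : ℕ) then R else 0 := by
    intro s hs hsn j
    have h0 : ¬ n + 1 - s ≤ ((0 : Fin (n + 1)) : ℕ) := by
      rw [Fin.val_zero]
      omega
    rw [hAw s hs hsn, hAw s hs hsn, hw0, if_neg h0]
    split_ifs <;> field_simp <;> ring
  have hli : LinearIndependent ℝ (fun s : Fin n => A ((s : ℕ) + 1)) := by
    let g : Fin (n + 1) → (Fin (n + 1) → ℝ) →ₗ[ℝ] ℝ :=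
      fun j => LinearMap.proj j - w j • LinearMap.proj 0
    refine linearIndependent_of_biorthogonal _
      (fun t => g t.rev.succ - g t.rev.castSucc) hR.ne' fun t s => ?_
    have hg : ∀ j, g j (A (s + 1)) = if n + 1 - (s + 1) ≤ (j : ℕ) then R else 0 :=
      fun j => hstep (s + 1) (by omega) (by omega) j
    rw [LinearMap.sub_apply, hg, hg]
    simp only [Fin.val_succ, Fin.val_castSucc, Fin.val_rev, Fin.ext_iff]
    split_ifs <;> first | omega | simp
  have htop : Pi ≠ ⊤ := by
    rintro rfl
    have h := (hPi (fun j => if j = 0 then 1 else 0)).1 Submodule.mem_top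
    simp at h
  exact ⟨hmem, hli, span_eq_and_finrank_eq_of_ne_top htop hli
    fun s => hmem (s + 1) (by omega) (by omega)⟩
end

section
/- For every x ∈ ℝ^{n+1} and every index 1 ≤ t ≤ n, the Euclidean inner product ⟨P(x), A_t⟩ equals (R/S)·(−X_t·T + S·Y_t), where T := x¹ + ∑_{i=2}^{n+1} a_i x^i and Y_t := ∑_{l=n+2−t}^{n+1} x^l. -/
/-- A sum over `Fin (n + 1)` of the terms with one-based index at least `m ≥ 1` is a sum over
the interval `[m, n + 1]`. -/
theorem sum_fin_ite_le_eq_sum_Icc {M : Type*} [AddCommMonoid M] (n m : ℕ) (hm : 1 ≤ m)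
    (f : ℕ → M) :
    ∑ j : Fin (n + 1), (if m ≤ (j : ℕ) + 1 then f ((j : ℕ) + 1) else 0) =
      ∑ i ∈ Finset.Icc m (n + 1), f i := by
  rw [Fin.sum_univ_eq_sum_range (fun j => if m ≤ j + 1 then f (j + 1) else 0) (n + 1),
    ← Finset.sum_filter]
  refine Finset.sum_bij (fun j _ => j + 1) ?_ ?_ ?_ ?_
  · intro j hj
    simp only [Finset.mem_filter, Finset.mem_range, Finset.mem_Icc] at hj ⊢
    omega
  · intro i _ j _ h
    omega
  · intro i hi
    rw [Finset.mem_Icc] at hi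
    refine ⟨i - 1, ?_, by omega⟩
    simp only [Finset.mem_filter, Finset.mem_range]
    omega
  · intro _ _
    rfl

/-- For every `x ∈ ℝ^{n+1}` and every `1 ≤ t ≤ n`, the Euclidean inner product
`⟨P(x), A_t⟩` equals `(R/S)·(−X_t·T + S·Y_t)`, where `T = x¹ + ∑_{i=2}^{n+1} a_i x^i` and
`Y_t = ∑_{l=n+2−t}^{n+1} x^l`. -/
theorem inner_projection_A
    (n : ℕ) (hn : 1 ≤ n)
    (a : ℕ → ℕ)
    (hapos : ∀ i, 2 ≤ i → i ≤ n + 1 → 0 < a i)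
    (R : ℝ) (hR : 0 < R)
    (S : ℝ) (hS : S = 1 + ∑ i ∈ Finset.Icc 2 (n + 1), (a i : ℝ) ^ 2)
    (X : ℕ → ℝ) (hX : ∀ s, X s = ∑ i ∈ Finset.Icc (n + 2 - s) (n + 1), (a i : ℝ))
    (A : ℕ → Fin (n + 1) → ℝ)
    (hA : ∀ s, 1 ≤ s → s ≤ n → ∀ j : Fin (n + 1),
      A s j =
        if (j : ℕ) + 1 = 1 then R / S * (-X s)
        else if (j : ℕ) + 1 ≤ n + 1 - s then R / S * (-(a ((j : ℕ) + 1) : ℝ) * X s)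
        else R / S * (S - (a ((j : ℕ) + 1) : ℝ) * X s))
    (v : Fin (n + 1) → ℝ)
    (hv : ∀ j : Fin (n + 1), v j = if (j : ℕ) = 0 then (1 : ℝ) else (a ((j : ℕ) + 1) : ℝ))
    (θ : (Fin (n + 1) → ℝ) → ℝ)
    (hθ : ∀ x, θ x =
      -(∑ j : Fin (n + 1), (if (j : ℕ) = 0 then (1 : ℝ) else (a ((j : ℕ) + 1) : ℝ)) * x j) / S)
    (P : (Fin (n + 1) → ℝ) → (Fin (n + 1) → ℝ))
    (hP : ∀ x, P x = x + θ x • v) :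
    ∀ x : Fin (n + 1) → ℝ, ∀ t : ℕ, 1 ≤ t → t ≤ n →
      ∑ j : Fin (n + 1), P x j * A t j =
        R / S * (-X t *
            (∑ j : Fin (n + 1), (if (j : ℕ) = 0 then (1 : ℝ) else (a ((j : ℕ) + 1) : ℝ)) * x j)
          + S * ∑ j : Fin (n + 1), (if n + 2 - t ≤ (j : ℕ) + 1 then x j else 0)) := by
  intro x t ht htn
  have hvv : ∑ j, v j * v j = S := by
    rw [hS, ← sum_fin_ite_le_eq_sum_Icc n 2 (by norm_num) (fun i => (a i : ℝ) ^ 2),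
      Fin.sum_univ_succ, Fin.sum_univ_succ]
    simp [hv, pow_two]
  have hve : ∑ j : Fin (n + 1), (if n + 2 - t ≤ (j : ℕ) + 1 then v j else 0) = X t := by
    rw [hX, ← sum_fin_ite_le_eq_sum_Icc n (n + 2 - t) (by omega) (fun i => (a i : ℝ))]
    refine Finset.sum_congr rfl fun j _ => ?_
    split_ifs with h
    · rw [hv, if_neg (by omega)]
    · rfl
  have hAv : ∀ j : Fin (n + 1),
      A t j = R / S * (S * (if n + 2 - t ≤ (j : ℕ) + 1 then 1 else 0) - X t * v j) := by
    intro j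
    rw [hA t ht htn, hv]
    split_ifs <;> first | omega | ring
  have hinner : ∀ y : Fin (n + 1) → ℝ, ∑ j, y j * A t j =
      R / S * (-X t * ∑ j, v j * y j
        + S * ∑ j : Fin (n + 1), (if n + 2 - t ≤ (j : ℕ) + 1 then y j else 0)) := by
    intro y
    simp only [Finset.mul_sum, ← Finset.sum_add_distrib]
    refine Finset.sum_congr rfl fun j _ => ?_
    rw [hAv]
    split_ifs <;> ring
  have hvA : ∑ j, v j * A t j = 0 := by
    rw [hinner, hvv, hve]
    ring
  have hPA : ∑ j, P x j * A t j = ∑ j, x j * A t j + θ x * ∑ j, v j * A t j := by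
    rw [Finset.mul_sum, ← Finset.sum_add_distrib]
    refine Finset.sum_congr rfl fun j _ => ?_
    rw [hP, Pi.add_apply, Pi.smul_apply, smul_eq_mul]
    ring
  rw [hPA, hvA, hinner]
  simp only [hv, mul_zero, add_zero]
end

section
/- The image under P of the scaled integer lattice R·ℤ^{n+1} ⊂ ℝ^{n+1} equals the ℤ-span Γ of the vectors A_1, …, A_n; that is, P(R·m) is an integer linear combination of A_1, …, A_n for every m ∈ ℤ^{n+1}, and conversely every element of Γ arises this way. -/
/-- Telescoping of consecutive differences, indexed in reverse order. -/
theorem sum_reverse_differences (n : ℕ) (f : ℕ → ℤ) (hf : f 0 = 0) (j : ℕ) (hj : j ≤ n) :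
    ∑ s ∈ Finset.Icc 1 n, (if n + 1 ≤ j + s then f (n + 1 - s) - f (n - s) else 0) = f j := by
  induction j with
  | zero =>
    rw [hf]
    refine Finset.sum_eq_zero fun s hs => if_neg ?_
    have := Finset.mem_Icc.mp hs
    lia
  | succ j ih =>
    have hsplit : ∀ s ∈ Finset.Icc 1 n,
        (if n + 1 ≤ j + 1 + s then f (n + 1 - s) - f (n - s) else 0) =
          (if n + 1 ≤ j + s then f (n + 1 - s) - f (n - s) else 0) +
            (if s = n - j then f (n + 1 - s) - f (n - s) else 0) := by
      intro s hs
      have := Finset.mem_Icc.mp hs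
      split_ifs <;> lia
    rw [Finset.sum_congr rfl hsplit, Finset.sum_add_distrib, ih (by lia), Finset.sum_ite_eq',
      if_pos (Finset.mem_Icc.mpr ⟨by lia, by lia⟩), show n + 1 - (n - j) = j + 1 by lia,
      show n - (n - j) = j by lia]
    ring

/-- A sum over the last `s` indices of `Fin (n + 1)`, in one-based numbering. -/
theorem sum_fin_last (n s : ℕ) (hs : s ≤ n) (g : ℕ → ℝ) :
    ∑ j : Fin (n + 1), (if (j : ℕ) = 0 then (1 : ℝ) else g ((j : ℕ) + 1)) *
        (if n + 1 ≤ (j : ℕ) + s then 1 else 0) =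
      ∑ i ∈ Finset.Icc (n + 2 - s) (n + 1), g i := by
  rw [Fin.sum_univ_eq_sum_range (fun j => (if j = 0 then (1 : ℝ) else g (j + 1)) *
    (if n + 1 ≤ j + s then 1 else 0)) (n + 1)]
  simp only [mul_ite, mul_one, mul_zero]
  rw [← Finset.sum_filter]
  refine Finset.sum_bij (fun j _ => j + 1) ?_ ?_ ?_ ?_
  · intro j hj
    simp only [Finset.mem_filter, Finset.mem_range, Finset.mem_Icc] at hj ⊢
    lia
  · intro i _ j _ h
    lia
  · intro i hi
    simp only [Finset.mem_Icc] at hi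
    exact ⟨i - 1, by simp only [Finset.mem_filter, Finset.mem_range]; lia, by lia⟩
  · intro j hj
    simp only [Finset.mem_filter, Finset.mem_range] at hj
    exact if_neg (by lia)

theorem sum_fin_mul_self (n : ℕ) (g : ℕ → ℝ) :
    ∑ j : Fin (n + 1), (if (j : ℕ) = 0 then (1 : ℝ) else g ((j : ℕ) + 1)) *
        (if (j : ℕ) = 0 then (1 : ℝ) else g ((j : ℕ) + 1)) =
      1 + ∑ i ∈ Finset.Icc 2 (n + 1), g i ^ 2 := by
  rw [Fin.sum_univ_succ]
  simp only [Fin.val_zero, if_true, Fin.val_succ, Nat.succ_ne_zero, if_false, ← sq, one_pow]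
  rw [Fin.sum_univ_eq_sum_range (fun j => g (j + 1 + 1) ^ 2) n, ← Finset.Ico_add_one_right_eq_Icc,
    Finset.sum_Ico_eq_sum_range]
  simp only [add_comm 2, add_assoc, Nat.reduceAdd, Nat.add_sub_cancel]

/-- The image under `P` of the scaled integer lattice `R·ℤ^{n+1}` equals the
`ℤ`-span `Γ` of the vectors `A_1, …, A_n`. -/
theorem projection_image_of_lattice
    (n : ℕ) (hn : 1 ≤ n)
    (a : ℕ → ℕ)
    (hapos : ∀ i, 2 ≤ i → i ≤ n + 1 → 0 < a i)
    (R : ℝ) (hR : 0 < R)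
    (S : ℝ) (hS : S = 1 + ∑ i ∈ Finset.Icc 2 (n + 1), (a i : ℝ) ^ 2)
    (X : ℕ → ℝ) (hX : ∀ s, X s = ∑ i ∈ Finset.Icc (n + 2 - s) (n + 1), (a i : ℝ))
    (A : ℕ → Fin (n + 1) → ℝ)
    (hA : ∀ s, 1 ≤ s → s ≤ n → ∀ j : Fin (n + 1),
      A s j =
        if (j : ℕ) + 1 = 1 then R / S * (-X s)
        else if (j : ℕ) + 1 ≤ n + 1 - s then R / S * (-(a ((j : ℕ) + 1) : ℝ) * X s)
        else R / S * (S - (a ((j : ℕ) + 1) : ℝ) * X s))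
    (v : Fin (n + 1) → ℝ)
    (hv : ∀ j : Fin (n + 1), v j = if (j : ℕ) = 0 then (1 : ℝ) else (a ((j : ℕ) + 1) : ℝ))
    (θ : (Fin (n + 1) → ℝ) → ℝ)
    (hθ : ∀ x, θ x =
      -(∑ j : Fin (n + 1), (if (j : ℕ) = 0 then (1 : ℝ) else (a ((j : ℕ) + 1) : ℝ)) * x j) / S)
    (P : (Fin (n + 1) → ℝ) → (Fin (n + 1) → ℝ))
    (hP : ∀ x, P x = x + θ x • v) :
    {y : Fin (n + 1) → ℝ | ∃ m : Fin (n + 1) → ℤ, y = P (fun j => R * (m j : ℝ))} =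
      {y : Fin (n + 1) → ℝ | ∃ c : ℕ → ℤ, y = ∑ s ∈ Finset.Icc 1 n, (c s : ℝ) • A s} := by
  have hSpos : 0 < S := by
    rw [hS]
    positivity
  have hPlin : IsLinearMap ℝ P := by
    constructor
    · intro x y
      simp only [hP, hθ, Pi.add_apply, mul_add, Finset.sum_add_distrib]
      module
    · intro c x
      simp only [hP, hθ, Pi.smul_apply, smul_eq_mul, mul_left_comm _ c, ← Finset.mul_sum]
      module
  have hPv : P v = 0 := by
    have hθv : θ v = -1 := by
      rw [hθ]
      simp only [hv]
      rw [sum_fin_mul_self n (fun i => (a i : ℝ)), ← hS, neg_div, div_self hSpos.ne']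
    rw [hP, hθv]
    module
  have hAP : ∀ s ∈ Finset.Icc 1 n,
      A s = P (R • fun j : Fin (n + 1) => if n + 1 ≤ (j : ℕ) + s then (1 : ℝ) else 0) := by
    intro s hs
    obtain ⟨hs1, hsn⟩ := Finset.mem_Icc.mp hs
    rw [hPlin.map_smul, hP, hθ, sum_fin_last n s hsn (fun i => (a i : ℝ)), ← hX]
    funext j
    rw [hA s hs1 hsn]
    simp only [Pi.smul_apply, Pi.add_apply, smul_eq_mul, hv]
    split_ifs <;> first | lia | (field_simp; ring)
  have hsum : ∀ c : ℕ → ℤ, ∑ s ∈ Finset.Icc 1 n, (c s : ℝ) • A s =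
      P (fun j => R * ((∑ s ∈ Finset.Icc 1 n,
        if n + 1 ≤ (j : ℕ) + s then c s else 0 : ℤ) : ℝ)) := by
    intro c
    calc ∑ s ∈ Finset.Icc 1 n, (c s : ℝ) • A s
        = ∑ s ∈ Finset.Icc 1 n, hPlin.mk' P ((c s : ℝ) • R •
            fun j : Fin (n + 1) => if n + 1 ≤ (j : ℕ) + s then (1 : ℝ) else 0) := by
          refine Finset.sum_congr rfl fun s hs => ?_
          rw [hAP s hs, IsLinearMap.mk'_apply, hPlin.map_smul (c s : ℝ)]
      _ = P (∑ s ∈ Finset.Icc 1 n, (c s : ℝ) • R •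
            fun j : Fin (n + 1) => if n + 1 ≤ (j : ℕ) + s then (1 : ℝ) else 0) := by
          rw [← map_sum, IsLinearMap.mk'_apply]
      _ = _ := by
          congr 1
          funext j
          push_cast
          simp only [Finset.sum_apply, Pi.smul_apply, smul_eq_mul, Finset.mul_sum]
          refine Finset.sum_congr rfl fun s _ => ?_
          split_ifs <;> ring
  ext y
  constructor
  · rintro ⟨m, rfl⟩
    -- Subtracting `m 0` times the kernel vector `v` makes the first coordinate vanish.
    let f : ℕ → ℤ := fun k =>
      m (Fin.ofNat (n + 1) k) - m 0 * (if k = 0 then 1 else (a (k + 1) : ℤ))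
    have hf : f 0 = 0 := by simp [f]
    refine ⟨fun s => f (n + 1 - s) - f (n - s), ?_⟩
    rw [hsum]
    have hdecomp : (fun j => R * (m j : ℝ)) =
        (fun j : Fin (n + 1) => R * (f j : ℝ)) + (R * (m 0 : ℝ)) • v := by
      funext j
      simp only [f, Pi.add_apply, Pi.smul_apply, smul_eq_mul, hv, Fin.ofNat_val_eq_self]
      push_cast
      ring
    rw [hdecomp, hPlin.map_add, hPlin.map_smul, hPv, smul_zero, add_zero]
    congr 1
    funext j
    rw [sum_reverse_differences n f hf j (by lia)]
  · rintro ⟨c, rfl⟩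
    exact ⟨_, hsum c⟩
end

section
/- The vectors A*_s := (1/R²)·∑_{t=1}^{n} B_{st}·A_t (1 ≤ s ≤ n) satisfy ⟨A*_s, A_t⟩ = δ_{st} (Kronecker delta) and ⟨A*_s, A*_t⟩ = B_{st}/R² for all 1 ≤ s, t ≤ n; moreover the set Γ* := {y ∈ span_ℝ{A_1, …, A_n} : ⟨y, A_s⟩ ∈ ℤ for all 1 ≤ s ≤ n} equals the ℤ-span of A*_1, …, A*_n. -/
open Finset

/-- Summing `f` against a row of the tridiagonal matrix with corner entry `1`. -/
theorem sum_Icc_tridiagonal_mul (n s : ℕ) (hs : 1 ≤ s) (hsn : s ≤ n) (f : ℕ → ℝ) (hf : f 0 = 0) :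
    ∑ t ∈ Icc 1 n, (if s = t then (if s = n then 1 else 2)
      else if t = s + 1 ∨ s = t + 1 then -1 else 0) * f t =
      (f s - f (s - 1)) - if s = n then 0 else f (s + 1) - f s := by
  have h : ∀ t ∈ Icc 1 n, (if s = t then (if s = n then 1 else 2)
      else if t = s + 1 ∨ s = t + 1 then -1 else 0) * f t =
      (if t = s then (if s = n then 1 else 2) * f t else 0) - (if t = s + 1 then f t else 0)
        - (if t = s - 1 then f t else 0) := by
    intro t ht
    rw [mem_Icc] at ht
    split_ifs <;> first | omega | simp
  rw [sum_congr rfl h, sum_sub_distrib, sum_sub_distrib, sum_ite_eq', sum_ite_eq', sum_ite_eq']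
  simp only [mem_Icc]
  rcases Nat.eq_or_lt_of_le hs with h1 | h1
  · subst h1
    split_ifs <;> first | omega | (simp [hf]; try ring)
  · split_ifs <;> first | omega | ring

/-- Telescoping sum over the last `j` indices of `Icc 1 n`, counted from the top. -/
theorem sum_Icc_telescope_reflect (n : ℕ) (w : ℕ → ℝ) (j : ℕ) (hj : j ≤ n) :
    ∑ t ∈ Icc 1 n, (w (n + 1 - t) - w (n + 2 - t)) * (if n + 1 ≤ j + t then 1 else 0) =
      w 1 - w (j + 1) := by
  induction j with
  | zero =>
    rw [zero_add, sub_self]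
    refine sum_eq_zero fun t ht => ?_
    rw [mem_Icc] at ht
    rw [if_neg (by omega), mul_zero]
  | succ j ih =>
    have h : ∀ t ∈ Icc 1 n,
        (w (n + 1 - t) - w (n + 2 - t)) * (if n + 1 ≤ j + 1 + t then 1 else 0) =
        (w (n + 1 - t) - w (n + 2 - t)) * (if n + 1 ≤ j + t then 1 else 0) +
          (if t = n - j then w (n + 1 - t) - w (n + 2 - t) else 0) := by
      intro t ht
      split_ifs <;> first | omega | simp
    rw [sum_congr rfl h, sum_add_distrib, ih (by omega), sum_ite_eq',
      if_pos (by rw [mem_Icc]; omega), show n + 1 - (n - j) = j + 1 by omega,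
      show n + 2 - (n - j) = j + 1 + 1 by omega]
    ring

/-- A vector in the span of `A '' I` is determined by its pairings with the `A s`: it is the
combination of a biorthogonal family in the span with these pairings as coefficients. -/
theorem eq_sum_dotProduct_smul_of_biorthogonal {ι m : Type*} [DecidableEq ι] [Fintype m]
    (I : Finset ι) (A D : ι → m → ℝ)
    (hD : ∀ s ∈ I, D s ∈ Submodule.span ℝ (A '' I))
    (hDA : ∀ s ∈ I, ∀ t ∈ I, D s ⬝ᵥ A t = if s = t then 1 else 0)
    {y : m → ℝ} (hy : y ∈ Submodule.span ℝ (A '' I)) :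
    y = ∑ s ∈ I, (y ⬝ᵥ A s) • D s := by
  set z := y - ∑ s ∈ I, (y ⬝ᵥ A s) • D s with hz
  have hzmem : z ∈ Submodule.span ℝ (A '' I) :=
    Submodule.sub_mem _ hy (Submodule.sum_mem _ fun s hs => Submodule.smul_mem _ _ (hD s hs))
  have hzA : ∀ t ∈ I, z ⬝ᵥ A t = 0 := by
    intro t ht
    rw [hz, sub_dotProduct, sum_dotProduct, sum_congr rfl fun s hs => by
      rw [smul_dotProduct, hDA s hs t ht, smul_eq_mul, mul_ite, mul_one, mul_zero],
      sum_ite_eq', if_pos ht, sub_self]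
  have hzspan : ∀ w ∈ Submodule.span ℝ (A '' I), z ⬝ᵥ w = 0 := by
    intro w hw
    induction hw using Submodule.span_induction with
    | mem x hx =>
      obtain ⟨t, ht, rfl⟩ := hx
      exact hzA t ht
    | zero => exact dotProduct_zero z
    | add x y _ _ hx hy => rw [dotProduct_add, hx, hy, add_zero]
    | smul c x _ hx => rw [dotProduct_smul, hx, smul_zero]
  exact sub_eq_zero.mp (dotProduct_self_eq_zero.mp (hzspan z hzmem))

/-- The vectors `A*_s := (1/R²)·∑_t B_{st}·A_t` satisfy `⟨A*_s, A_t⟩ = δ_{st}`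
and `⟨A*_s, A*_t⟩ = B_{st}/R²`; moreover the set
`Γ* = {y ∈ span_ℝ{A_1,…,A_n} : ⟨y, A_s⟩ ∈ ℤ ∀s}` equals the `ℤ`-span of `A*_1, …, A*_n`. -/
theorem dual_lattice_basis
    (n : ℕ) (hn : 1 ≤ n)
    (a : ℕ → ℕ) (ha1 : a 1 = 0)
    (hapos : ∀ i, 2 ≤ i → i ≤ n + 1 → 0 < a i)
    (R : ℝ) (hR : 0 < R)
    (S : ℝ) (hS : S = 1 + ∑ i ∈ Finset.Icc 2 (n + 1), (a i : ℝ) ^ 2)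
    (X : ℕ → ℝ) (hX : ∀ s, X s = ∑ i ∈ Finset.Icc (n + 2 - s) (n + 1), (a i : ℝ))
    (N : ℕ → ℝ) (hN : ∀ s, 1 ≤ s → s ≤ n → N s = (a (n + 1 - s) : ℝ) - (a (n + 2 - s) : ℝ))
    (A : ℕ → Fin (n + 1) → ℝ)
    (hA : ∀ s, 1 ≤ s → s ≤ n → ∀ j : Fin (n + 1),
      A s j =
        if (j : ℕ) + 1 = 1 then R / S * (-X s)
        else if (j : ℕ) + 1 ≤ n + 1 - s then R / S * (-(a ((j : ℕ) + 1) : ℝ) * X s)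
        else R / S * (S - (a ((j : ℕ) + 1) : ℝ) * X s))
    (B : ℕ → ℕ → ℝ)
    (hB : ∀ s t, 1 ≤ s → s ≤ n → 1 ≤ t → t ≤ n → B s t =
      if s = t then (if s = n then 1 + N n ^ 2 else 2 + N s ^ 2)
      else if t = s + 1 ∨ s = t + 1 then -1 + N s * N t
      else N s * N t)
    (Astar : ℕ → Fin (n + 1) → ℝ)
    (hAstar : ∀ s, 1 ≤ s → s ≤ n →
      Astar s = (R ^ 2)⁻¹ • ∑ t ∈ Finset.Icc 1 n, B s t • A t) :
    (∀ s t, 1 ≤ s → s ≤ n → 1 ≤ t → t ≤ n →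
        ∑ j : Fin (n + 1), Astar s j * A t j = if s = t then 1 else 0) ∧
      (∀ s t, 1 ≤ s → s ≤ n → 1 ≤ t → t ≤ n →
        ∑ j : Fin (n + 1), Astar s j * Astar t j = B s t / R ^ 2) ∧
      {y : Fin (n + 1) → ℝ |
          y ∈ Submodule.span ℝ (A '' ↑(Finset.Icc 1 n)) ∧
          ∀ s ∈ Finset.Icc 1 n, ∃ k : ℤ, ∑ j : Fin (n + 1), y j * A s j = (k : ℝ)} =
        {y : Fin (n + 1) → ℝ |
          ∃ c : ℕ → ℤ, y = ∑ s ∈ Finset.Icc 1 n, (c s : ℝ) • Astar s} := by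
  -- `v` is the normal vector `(1, a₂, …, a_{n+1})`, `u t` the indicator of the last `t` coordinates,
  -- and `Q s` is `R` times the dual vector `A*_s`.
  set v : ℕ → ℝ := fun j => if j = 0 then 1 else (a (j + 1) : ℝ) with hv
  set u : ℕ → ℕ → ℝ := fun t j => if n + 1 ≤ j + t then 1 else 0 with hu
  set Q : ℕ → ℕ → ℝ := fun s j => (if j = n + 1 - s then 1 else 0) - (if j = n - s then 1 else 0)
    + (if j = 0 then v (n - s) - v (n + 1 - s) else 0) with hQ
  have hSpos : 0 < S := by
    rw [hS]
    positivity
  have hSv : S = ∑ j ∈ range (n + 1), v j * v j := by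
    rw [hS, sum_range_succ', add_comm]
    congr 1
    · refine sum_nbij' (fun i => i - 2) (fun j => j + 2) ?_ ?_ ?_ ?_ ?_ <;> intro i hi <;>
        simp only [mem_Icc, mem_range] at hi ⊢
      any_goals omega
      rw [hv]
      simp only [Nat.add_eq_zero_iff, one_ne_zero, and_false, if_false]
      rw [show i - 2 + 1 + 1 = i by omega, sq]
    · simp [hv]
  have hXu : ∀ t, 1 ≤ t → t ≤ n → X t = ∑ j ∈ range (n + 1), u t j * v j := by
    intro t ht htn
    simp only [hu, ite_mul, one_mul, zero_mul]
    rw [hX t, ← sum_filter]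
    refine sum_nbij' (fun i => i - 1) (fun j => j + 1) ?_ ?_ ?_ ?_ ?_ <;> intro i hi <;>
      simp only [mem_Icc, mem_range, mem_filter] at hi ⊢
    any_goals omega
    rw [hv]
    simp only
    rw [if_neg (by omega), show i - 1 + 1 = i by omega]
  have hAu : ∀ t, 1 ≤ t → t ≤ n → ∀ j : Fin (n + 1),
      A t j = R * (u t j - X t / S * v j) := by
    intro t ht htn j
    have hj := j.isLt
    rw [hA t ht htn j]
    simp only [hu, hv]
    split_ifs <;> first | omega | (field_simp; try ring)
  have hQsum : ∀ s, 1 ≤ s → s ≤ n → ∀ g : ℕ → ℝ, ∑ j ∈ range (n + 1), Q s j * g j =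
      g (n + 1 - s) - g (n - s) + (v (n - s) - v (n + 1 - s)) * g 0 := by
    intro s hs hsn g
    simp only [hQ, add_mul, sub_mul, ite_mul, one_mul, zero_mul, sum_add_distrib, sum_sub_distrib,
      sum_ite_eq', mem_range]
    rw [if_pos (by omega), if_pos (by omega), if_pos (by omega)]
  have hQv : ∀ s, 1 ≤ s → s ≤ n → ∑ j ∈ range (n + 1), Q s j * v j = 0 := by
    intro s hs hsn
    rw [hQsum s hs hsn, show v 0 = 1 from if_pos rfl]
    ring
  have hBu : ∀ s, 1 ≤ s → s ≤ n → ∀ j, j ≤ n →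
      ∑ t ∈ Icc 1 n, B s t * u t j = Q s j - N s * v j := by
    intro s hs hsn j hj
    have hsplit : ∀ t ∈ Icc 1 n, B s t * u t j = (if s = t then (if s = n then 1 else 2)
        else if t = s + 1 ∨ s = t + 1 then -1 else 0) * u t j +
        N s * (((a (n + 1 - t) : ℝ) - (a (n + 2 - t) : ℝ)) * u t j) := by
      intro t ht
      rw [mem_Icc] at ht
      rw [hB s t hs hsn ht.1 ht.2, ← hN t ht.1 ht.2]
      split_ifs <;> subst_vars <;> ring
    rw [sum_congr rfl hsplit, sum_add_distrib, ← mul_sum,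
      sum_Icc_telescope_reflect n (fun i => (a i : ℝ)) j hj,
      sum_Icc_tridiagonal_mul n s hs hsn (fun t => u t j) (if_neg (by omega)), hN s hs hsn, ha1]
    simp only [hu, hQ, hv]
    rw [show n + 2 - s = n + 1 - s + 1 by omega, if_neg (show n + 1 - s ≠ 0 by omega)]
    rcases Nat.eq_or_lt_of_le hsn with rfl | hlt
    · simp only [Nat.sub_self, Nat.add_sub_cancel_left, if_true, zero_add]
      split_ifs <;> first | omega | (subst_vars; simp [ha1]; try ring)
    · rw [if_neg (show n - s ≠ 0 by omega), if_neg hlt.ne, show n + 1 - s = n - s + 1 by omega]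
      split_ifs <;> first | omega | (subst_vars; simp [ha1]; try ring)
  have hBX : ∀ s, 1 ≤ s → s ≤ n → ∑ t ∈ Icc 1 n, B s t * X t = -(N s * S) := by
    intro s hs hsn
    calc ∑ t ∈ Icc 1 n, B s t * X t
        = ∑ t ∈ Icc 1 n, ∑ j ∈ range (n + 1), B s t * u t j * v j := by
          refine sum_congr rfl fun t ht => ?_
          rw [mem_Icc] at ht
          simp only [hXu t ht.1 ht.2, mul_sum, mul_assoc]
      _ = ∑ j ∈ range (n + 1), (Q s j * v j - N s * (v j * v j)) := by
          rw [sum_comm]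
          refine sum_congr rfl fun j hj => ?_
          rw [← sum_mul, hBu s hs hsn j (by rw [mem_range] at hj; omega)]
          ring
      _ = -(N s * S) := by
          rw [sum_sub_distrib, hQv s hs hsn, ← mul_sum, ← hSv, zero_sub]
  have hAstarQ : ∀ s, 1 ≤ s → s ≤ n → ∀ j : Fin (n + 1), Astar s j = R⁻¹ * Q s j := by
    intro s hs hsn j
    have hj := j.isLt
    have hsum : ∑ t ∈ Icc 1 n, B s t * A t j =
        R * (∑ t ∈ Icc 1 n, B s t * u t j - (∑ t ∈ Icc 1 n, B s t * X t) / S * v j) := by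
      rw [sum_div, sum_mul, ← sum_sub_distrib, mul_sum]
      refine sum_congr rfl fun t ht => ?_
      rw [mem_Icc] at ht
      rw [hAu t ht.1 ht.2]
      ring
    rw [hBu s hs hsn j (by omega), hBX s hs hsn] at hsum
    simp only [hAstar s hs hsn, Pi.smul_apply, Finset.sum_apply, smul_eq_mul]
    rw [hsum]
    field_simp
    ring
  have hdual : ∀ s t, 1 ≤ s → s ≤ n → 1 ≤ t → t ≤ n →
      ∑ j : Fin (n + 1), Astar s j * A t j = if s = t then 1 else 0 := by
    intro s t hs hsn ht htn
    calc ∑ j : Fin (n + 1), Astar s j * A t j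
        = ∑ j : Fin (n + 1), (Q s j * u t j - X t / S * (Q s j * v j)) := by
          refine sum_congr rfl fun j _ => ?_
          rw [hAstarQ s hs hsn, hAu t ht htn]
          field_simp
      _ = ∑ j ∈ range (n + 1), (Q s j * u t j - X t / S * (Q s j * v j)) :=
          Fin.sum_univ_eq_sum_range (fun j => Q s j * u t j - X t / S * (Q s j * v j)) (n + 1)
      _ = if s = t then 1 else 0 := by
          rw [sum_sub_distrib, ← mul_sum, hQv s hs hsn, hQsum s hs hsn]
          simp only [hu]
          split_ifs <;> first | omega | simp
  have hsymm : ∀ s t, 1 ≤ s → s ≤ n → 1 ≤ t → t ≤ n → B s t = B t s := by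
    intro s t hs hsn ht htn
    rw [hB s t hs hsn ht htn, hB t s ht htn hs hsn]
    split_ifs <;> first | omega | (subst_vars; ring)
  have hmem : ∀ s ∈ Icc 1 n, Astar s ∈ Submodule.span ℝ (A '' ↑(Icc 1 n)) := by
    intro s hs
    rw [mem_Icc] at hs
    rw [hAstar s hs.1 hs.2]
    exact Submodule.smul_mem _ _ (Submodule.sum_mem _ fun t ht =>
      Submodule.smul_mem _ _ (Submodule.subset_span ⟨t, ht, rfl⟩))
  have hdual' : ∀ s ∈ Icc 1 n, ∀ t ∈ Icc 1 n, Astar s ⬝ᵥ A t = if s = t then 1 else 0 := by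
    intro s hs t ht
    rw [mem_Icc] at hs ht
    exact hdual s t hs.1 hs.2 ht.1 ht.2
  refine ⟨hdual, ?_, ?_⟩
  · intro s t hs hsn ht htn
    change Astar s ⬝ᵥ Astar t = _
    rw [hAstar t ht htn, dotProduct_smul, dotProduct_sum, sum_congr rfl fun r hr => by
      rw [dotProduct_smul, hdual' s (mem_Icc.mpr ⟨hs, hsn⟩) r hr, smul_eq_mul, mul_ite, mul_one,
        mul_zero], sum_ite_eq, if_pos (mem_Icc.mpr ⟨hs, hsn⟩), hsymm t s ht htn hs hsn,
      smul_eq_mul, div_eq_inv_mul]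
  · ext y
    constructor
    · rintro ⟨hy, hint⟩
      choose! c hc using hint
      refine ⟨c, (eq_sum_dotProduct_smul_of_biorthogonal _ A Astar hmem hdual' hy).trans ?_⟩
      refine sum_congr rfl fun s hs => ?_
      rw [← hc s hs]
      rfl
    · rintro ⟨c, rfl⟩
      refine ⟨Submodule.sum_mem _ fun s hs => Submodule.smul_mem _ _ (hmem s hs), fun t ht => ?_⟩
      refine ⟨c t, ?_⟩
      change (∑ s ∈ Icc 1 n, (c s : ℝ) • Astar s) ⬝ᵥ A t = _
      rw [sum_dotProduct, sum_congr rfl fun s hs => by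
        rw [smul_dotProduct, hdual' s hs t ht, smul_eq_mul, mul_ite, mul_one, mul_zero],
        sum_ite_eq', if_pos ht]
end

section
/- For every δ = (δ_1, …, δ_n) ∈ ℝⁿ, the squared Euclidean norm of y = ∑_{s=1}^{n} δ_s·A*_s equals (1/R²)·[ 2·∑_{s=1}^{n−1}(δ_s² − δ_s·δ_{s+1}) + δ_n² + (∑_{s=1}^{n} δ_s·N_s)² ]. -/
open Finset

/-- Summation by parts for a sequence `X` with increments `D`. -/
theorem sum_Icc_diff_mul_partial_sum (D X : ℕ → ℝ) (m : ℕ) (h0 : X 0 = 0)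
    (hX : ∀ t < m, X (t + 1) = X t + D (t + 1)) :
    ∑ t ∈ Icc 1 m, (D (t + 1) - D t) * X t = D (m + 1) * X m - ∑ t ∈ Icc 1 m, D t ^ 2 := by
  induction m with
  | zero => simp [h0]
  | succ m ih =>
    rw [sum_Icc_succ_top (by omega), sum_Icc_succ_top (by omega),
      ih fun t ht => hX t (by omega), hX m (by omega)]
    ring

theorem sum_Icc_diff_mul_indicator (D : ℕ → ℝ) (p m : ℕ) (hp : 1 ≤ p) :
    ∑ t ∈ Icc 1 m, (D (t + 1) - D t) * (if p ≤ t then 1 else 0) =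
      if p ≤ m then D (m + 1) - D p else 0 := by
  induction m with
  | zero => simp; omega
  | succ m ih =>
    rw [sum_Icc_succ_top (by omega), ih]
    rcases lt_trichotomy p (m + 1) with h | h | h
    · simp [show p ≤ m by omega, h.le]
    · subst h; simp
    · simp [show ¬ p ≤ m by omega, show ¬ p ≤ m + 1 by omega]

theorem sum_Icc_top_segment_succ (f : ℕ → ℝ) (n s : ℕ) (hs : s ≤ n) :
    ∑ i ∈ Icc (n + 2 - (s + 1)) (n + 1), f i =
      ∑ i ∈ Icc (n + 2 - s) (n + 1), f i + f (n + 2 - (s + 1)) := by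
  have h : Icc (n + 2 - (s + 1)) (n + 1) =
      insert (n + 2 - (s + 1)) (Icc (n + 2 - s) (n + 1)) := by
    ext i; simp only [mem_insert, mem_Icc]; omega
  rw [h, sum_insert (by simp only [mem_Icc]; omega), add_comm]

theorem sum_Icc_top_segment (f : ℕ → ℝ) (n m : ℕ) (hm : m ≤ n) :
    ∑ i ∈ Icc (n + 2 - m) (n + 1), f i = ∑ t ∈ Icc 1 m, f (n + 2 - t) := by
  induction m with
  | zero => simp
  | succ m ih =>
    rw [sum_Icc_top_segment_succ f n m (by omega), ih (by omega), sum_Icc_succ_top (by omega)]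

/-- The tridiagonal part of the matrix acts as a second difference, with a Dirichlet condition
at `0` and a Neumann condition at `n`. -/
theorem sum_tridiagonal_add_rank_one (n : ℕ) (N F : ℕ → ℝ) (B : ℕ → ℕ → ℝ)
    (hB : ∀ s t, 1 ≤ s → s ≤ n → 1 ≤ t → t ≤ n → B s t =
      if s = t then (if s = n then 1 + N n ^ 2 else 2 + N s ^ 2)
      else if t = s + 1 ∨ s = t + 1 then -1 + N s * N t
      else N s * N t)
    (h0 : F 0 = 0) (hF : F (n + 1) = F n) (s : ℕ) (hs : 1 ≤ s) (hsn : s ≤ n) :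
    ∑ t ∈ Icc 1 n, B s t * F t =
      N s * ∑ t ∈ Icc 1 n, N t * F t + (2 * F s - F (s - 1) - F (s + 1)) := by
  have hterm : ∀ t ∈ Icc 1 n, B s t * F t = N s * (N t * F t) +
      ((if s = t then (if s = n then 1 else 2) * F t else 0) - (if s + 1 = t then F t else 0)
        - (if s - 1 = t then F t else 0)) := by
    intro t ht
    rw [mem_Icc] at ht
    rw [hB s t hs hsn ht.1 ht.2]
    rcases eq_or_ne s t with rfl | hst
    · simp only [if_true, show ¬ s + 1 = s by omega, show ¬ s - 1 = s by omega, if_false]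
      split_ifs with h
      · subst h; ring
      · ring
    · rw [if_neg hst, if_neg hst]
      by_cases h1 : t = s + 1
      · simp [h1, show ¬ s - 1 = s + 1 by omega]; ring
      · by_cases h2 : s = t + 1
        · simp [h2, show ¬ t + 1 + 1 = t by omega]; ring
        · simp [h1, h2, Ne.symm h1, show ¬ s - 1 = t by omega]; ring
  rw [sum_congr rfl hterm, sum_add_distrib, ← mul_sum, sum_sub_distrib, sum_sub_distrib,
    sum_ite_eq, sum_ite_eq, sum_ite_eq]
  congr 1
  rw [if_pos (mem_Icc.2 ⟨hs, hsn⟩)]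
  have hpred : (if s - 1 ∈ Icc 1 n then F (s - 1) else 0) = F (s - 1) := by
    split_ifs with h
    · rfl
    · rw [mem_Icc] at h
      rw [show s - 1 = 0 by omega, h0]
  rw [hpred]
  rcases eq_or_ne s n with rfl | h
  · simp [hF]; ring
  · simp [h, show s + 1 ≤ n by omega]; ring

theorem sum_range_sq_sub_pred (δ : ℕ → ℝ) (m : ℕ) :
    ∑ i ∈ range (m + 1), (δ (i + 1) - if i = 0 then 0 else δ i) ^ 2 =
      2 * ∑ s ∈ Icc 1 m, (δ s ^ 2 - δ s * δ (s + 1)) + δ (m + 1) ^ 2 := by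
  induction m with
  | zero => simp
  | succ m ih =>
    rw [sum_range_succ, ih, sum_Icc_succ_top (by omega)]
    simp
    ring

/-- For every `δ ∈ ℝⁿ`, the squared Euclidean norm of `y = ∑ δ_s·A*_s` equals
`(1/R²)·[2·∑_{s=1}^{n−1}(δ_s² − δ_s·δ_{s+1}) + δ_n² + (∑ δ_s·N_s)²]`. -/
theorem dual_norm_formula
    (n : ℕ) (hn : 1 ≤ n)
    (a : ℕ → ℕ) (ha1 : a 1 = 0)
    (hapos : ∀ i, 2 ≤ i → i ≤ n + 1 → 0 < a i)
    (R : ℝ) (hR : 0 < R)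
    (S : ℝ) (hS : S = 1 + ∑ i ∈ Finset.Icc 2 (n + 1), (a i : ℝ) ^ 2)
    (X : ℕ → ℝ) (hX : ∀ s, X s = ∑ i ∈ Finset.Icc (n + 2 - s) (n + 1), (a i : ℝ))
    (N : ℕ → ℝ) (hN : ∀ s, 1 ≤ s → s ≤ n → N s = (a (n + 1 - s) : ℝ) - (a (n + 2 - s) : ℝ))
    (A : ℕ → Fin (n + 1) → ℝ)
    (hA : ∀ s, 1 ≤ s → s ≤ n → ∀ j : Fin (n + 1),
      A s j =
        if (j : ℕ) + 1 = 1 then R / S * (-X s)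
        else if (j : ℕ) + 1 ≤ n + 1 - s then R / S * (-(a ((j : ℕ) + 1) : ℝ) * X s)
        else R / S * (S - (a ((j : ℕ) + 1) : ℝ) * X s))
    (B : ℕ → ℕ → ℝ)
    (hB : ∀ s t, 1 ≤ s → s ≤ n → 1 ≤ t → t ≤ n → B s t =
      if s = t then (if s = n then 1 + N n ^ 2 else 2 + N s ^ 2)
      else if t = s + 1 ∨ s = t + 1 then -1 + N s * N t
      else N s * N t)
    (Astar : ℕ → Fin (n + 1) → ℝ)
    (hAstar : ∀ s, 1 ≤ s → s ≤ n →
      Astar s = (R ^ 2)⁻¹ • ∑ t ∈ Finset.Icc 1 n, B s t • A t) :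
    ∀ δ : ℕ → ℝ,
      ∑ j : Fin (n + 1), ((∑ s ∈ Finset.Icc 1 n, δ s • Astar s) j) ^ 2 =
        (R ^ 2)⁻¹ * (2 * ∑ s ∈ Finset.Icc 1 (n - 1), (δ s ^ 2 - δ s * δ (s + 1))
          + δ n ^ 2 + (∑ s ∈ Finset.Icc 1 n, δ s * N s) ^ 2) := by
  intro δ
  have hSpos : 0 < S := by rw [hS]; positivity
  have hX0 : X 0 = 0 := by simp [hX]
  set D : ℕ → ℝ := fun t => (a (n + 2 - t) : ℝ) with hD
  have hXsucc : ∀ t ≤ n, X (t + 1) = X t + D (t + 1) := fun t ht => by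
    rw [hX, hX, sum_Icc_top_segment_succ (fun i => (a i : ℝ)) n t ht]
  have hDtop : D (n + 1) = 0 := by simp [hD, ha1]
  have hND : ∀ s ∈ Icc 1 n, N s = D (s + 1) - D s := fun s hs => by
    rw [mem_Icc] at hs
    rw [hN s hs.1 hs.2]
    simp [hD]
  have hsumD : ∑ t ∈ Icc 1 n, D t ^ 2 = S - 1 := by
    have h := sum_Icc_top_segment (fun i => (a i : ℝ) ^ 2) n n le_rfl
    rw [show n + 2 - n = 2 by omega] at h
    rw [hS, h]
    simp [hD]
  have hNX : ∑ t ∈ Icc 1 n, N t * X t = 1 - S := by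
    rw [sum_congr rfl fun t ht => by rw [hND t ht],
      sum_Icc_diff_mul_partial_sum D X n hX0 fun t ht => hXsucc t ht.le, hDtop, hsumD]
    ring
  have hXtop : X (n + 1) = X n := by rw [hXsucc n le_rfl, hDtop, add_zero]
  have hXdiff : ∀ s ∈ Icc 1 n, 2 * X s - X (s - 1) - X (s + 1) = - N s := fun s hs => by
    rw [hND s hs]
    rw [mem_Icc] at hs
    obtain ⟨r, rfl⟩ : ∃ r, s = r + 1 := ⟨s - 1, by omega⟩
    rw [hXsucc (r + 1) hs.2, Nat.add_sub_cancel, hXsucc r (by omega)]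
    ring
  have hstar : ∀ s ∈ Icc 1 n, ∀ j, Astar s j = (R ^ 2)⁻¹ * ∑ t ∈ Icc 1 n, B s t * A t j :=
    fun s hs j => by
      rw [mem_Icc] at hs
      simp [hAstar s hs.1 hs.2]
  have hstar_zero : ∀ s ∈ Icc 1 n, Astar s 0 = R⁻¹ * N s := fun s hs => by
    have hs' := mem_Icc.1 hs
    have hA0 : ∀ t ∈ Icc 1 n, B s t * A t 0 = -(R / S) * (B s t * X t) := fun t ht => by
      rw [mem_Icc] at ht
      rw [hA t ht.1 ht.2]
      simp
      ring
    rw [hstar s hs, sum_congr rfl hA0, ← mul_sum,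
      sum_tridiagonal_add_rank_one n N X B hB hX0 hXtop s hs'.1 hs'.2, hNX, hXdiff s hs]
    field_simp
    ring
  have hstar_succ : ∀ s ∈ Icc 1 n, ∀ i : Fin n, Astar s i.succ =
      R⁻¹ * ((if n - i = s then 1 else 0) - (if n - i - 1 = s then 1 else 0)) := fun s hs i => by
    have hs' := mem_Icc.1 hs
    have hi := i.isLt
    set p := n - (i : ℕ) with hp
    have hDp : D p = a (i + 1 + 1) := by
      simp only [hD]; congr 2; omega
    set g : ℕ → ℝ := fun t => if p ≤ t then 1 else 0 with hg
    have hAi : ∀ t ∈ Icc 1 n, B s t * A t i.succ =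
        R * (B s t * g t) - R / S * D p * (B s t * X t) := fun t ht => by
      rw [mem_Icc] at ht
      rw [hA t ht.1 ht.2, hDp]
      by_cases h : p ≤ t
      · simp [hg, h, show ¬ (i : ℕ) + 1 + 1 ≤ n + 1 - t by omega]
        field_simp
      · simp [hg, h, show (i : ℕ) + 1 + 1 ≤ n + 1 - t by omega]
        ring
    have hNg : ∑ t ∈ Icc 1 n, N t * g t = - D p := by
      rw [sum_congr rfl fun t ht => by rw [hND t ht],
        sum_Icc_diff_mul_indicator D p n (by omega), if_pos (by omega), hDtop]
      ring
    have hgdiff : 2 * g s - g (s - 1) - g (s + 1) =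
        (if p = s then 1 else 0) - (if p - 1 = s then 1 else 0) := by
      simp only [hg]
      rcases lt_trichotomy p s with h | h | h
      · simp [h.le, show p ≤ s - 1 by omega, show p ≤ s + 1 by omega, show ¬ p = s by omega,
          show ¬ p - 1 = s by omega]
        norm_num
      · simp [h, show ¬ s ≤ s - 1 by omega, show ¬ s - 1 = s by omega]
        norm_num
      · by_cases h1 : p = s + 1
        · simp [h1, show ¬ s + 1 ≤ s - 1 by omega]
        · simp [show ¬ p ≤ s by omega, show ¬ p ≤ s - 1 by omega, show ¬ p ≤ s + 1 by omega,
            show ¬ p = s by omega, show ¬ p - 1 = s by omega]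
    rw [hstar s hs, sum_congr rfl hAi, sum_sub_distrib, ← mul_sum, ← mul_sum,
      sum_tridiagonal_add_rank_one n N X B hB hX0 hXtop s hs'.1 hs'.2,
      sum_tridiagonal_add_rank_one n N g B hB (by simp [hg]; omega)
        (by simp [hg, hp, show n ≤ n + 1 + i by omega]) s hs'.1 hs'.2, hNX, hXdiff s hs, hNg, hgdiff]
    field_simp
    ring
  have hy_zero : (∑ s ∈ Icc 1 n, δ s • Astar s) 0 = R⁻¹ * ∑ s ∈ Icc 1 n, δ s * N s := by
    rw [Finset.sum_apply, mul_sum]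
    refine sum_congr rfl fun s hs => ?_
    rw [Pi.smul_apply, smul_eq_mul, hstar_zero s hs]
    ring
  have hy_succ : ∀ i : Fin n, (∑ s ∈ Icc 1 n, δ s • Astar s) i.succ =
      R⁻¹ * (δ (n - 1 - i + 1) - if n - 1 - i = 0 then 0 else δ (n - 1 - i)) := fun i => by
    have hi := i.isLt
    have hterm : ∀ s ∈ Icc 1 n, (δ s • Astar s) i.succ =
        R⁻¹ * ((if n - i = s then δ s else 0) - (if n - i - 1 = s then δ s else 0)) :=
      fun s hs => by
        rw [Pi.smul_apply, smul_eq_mul, hstar_succ s hs i]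
        split_ifs <;> ring
    rw [Finset.sum_apply, sum_congr rfl hterm, ← mul_sum, sum_sub_distrib, sum_ite_eq, sum_ite_eq,
      if_pos (by rw [mem_Icc]; omega), show n - (i : ℕ) - 1 = n - 1 - i by omega,
      show n - (i : ℕ) = n - 1 - i + 1 by omega]
    congr 2
    by_cases h : n - 1 - (i : ℕ) = 0
    · simp [h]
    · rw [if_pos (by rw [mem_Icc]; omega), if_neg h]
  obtain ⟨m, rfl⟩ : ∃ m, n = m + 1 := ⟨n - 1, by omega⟩
  have hsq_succ : ∑ i : Fin (m + 1), ((∑ s ∈ Icc 1 (m + 1), δ s • Astar s) i.succ) ^ 2 =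
      R⁻¹ ^ 2 * (2 * ∑ s ∈ Icc 1 m, (δ s ^ 2 - δ s * δ (s + 1)) + δ (m + 1) ^ 2) := by
    simp_rw [hy_succ, mul_pow]
    rw [← mul_sum, Fin.sum_univ_eq_sum_range (fun i => (δ (m + 1 - 1 - i + 1) -
        if m + 1 - 1 - i = 0 then 0 else δ (m + 1 - 1 - i)) ^ 2) (m + 1),
      sum_range_reflect (fun i => (δ (i + 1) - if i = 0 then 0 else δ i) ^ 2) (m + 1),
      sum_range_sq_sub_pred]
  rw [Fin.sum_univ_succ, hy_zero, hsq_succ, Nat.add_sub_cancel]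
  ring
end

section
/- For every δ = (δ_1, …, δ_n) with each δ_s ∈ {−1, 0, 1} and δ ≠ 0, the squared Euclidean norm of y = ∑_{s=1}^{n} δ_s·A*_s satisfies ‖y‖² ≥ 2/R². -/
open Finset

theorem sum_Icc_one_eq_sum_range {M : Type*} [AddCommMonoid M] (f : ℕ → M) (n : ℕ) :
    ∑ t ∈ Icc 1 n, f t = ∑ t ∈ range n, f (t + 1) := by
  induction n with
  | zero => simp
  | succ n ih => rw [Finset.sum_Icc_succ_top (by omega), ih, Finset.sum_range_succ]

/-- Summation by parts with vanishing boundary terms. -/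
theorem sum_range_sub_mul_eq_neg (b g : ℕ → ℝ) (n : ℕ) (hb : b n = 0) (hg : g 0 = 0) :
    ∑ t ∈ range n, (b (t + 1) - b t) * g (t + 1)
      = -∑ t ∈ range n, b t * (g (t + 1) - g t) := by
  have h := Finset.sum_range_sub (fun t => b t * g t) n
  simp only [hb, hg, zero_mul, mul_zero, sub_zero] at h
  rw [eq_neg_iff_add_eq_zero, ← Finset.sum_add_distrib, ← h]
  exact Finset.sum_congr rfl fun t _ => by ring

/-- A row of the path-graph second-difference matrix, with Dirichlet condition at `0` and Neumann
condition at `n`, acts as a second difference. -/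
theorem sum_range_secondDifference (g : ℕ → ℝ) (n s : ℕ) (hs : s < n) (h0 : g 0 = 0)
    (hn : g (n + 1) = g n) :
    ∑ t ∈ range n, (if s = t then (if s + 1 = n then (1 : ℝ) else 2)
      else if t = s + 1 ∨ s = t + 1 then -1 else 0) * g (t + 1)
      = (g (s + 1) - g s) - (g (s + 2) - g (s + 1)) := by
  have split : ∀ t ∈ range n, (if s = t then (if s + 1 = n then (1 : ℝ) else 2)
      else if t = s + 1 ∨ s = t + 1 then -1 else 0) * g (t + 1)
      = (if s = t then (if s + 1 = n then (1 : ℝ) else 2) * g (t + 1) else 0)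
        - (if s + 1 = t then g (t + 1) else 0) - (if s = t + 1 then g (t + 1) else 0) := by
    intro t _
    split_ifs <;> first | omega | ring
  have lower : ∑ t ∈ range n, (if s = t + 1 then g (t + 1) else 0) = g s := by
    cases s with
    | zero => simp [h0]
    | succ k =>
      simp only [Nat.add_right_cancel_iff, Finset.sum_ite_eq, Finset.mem_range]
      rw [if_pos (by omega)]
  rw [Finset.sum_congr rfl split, Finset.sum_sub_distrib, Finset.sum_sub_distrib, lower,
    Finset.sum_ite_eq, Finset.sum_ite_eq, if_pos (Finset.mem_range.2 hs)]
  simp only [Finset.mem_range]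
  by_cases h : s + 1 = n
  · subst h
    simp only [lt_irrefl, if_true, if_false]
    linarith
  · rw [if_neg h, if_pos (by omega)]
    ring

/-- A nonzero integer vector has squared length at least two, once the square of its pairing with
a vector of positive integers is added. -/
theorem two_le_sum_sq_add_sq_sum_mul {ι : Type*} [DecidableEq ι] (I : Finset ι) (e b : ι → ℤ)
    (hb : ∀ i ∈ I, 0 < b i) (he : ∃ i ∈ I, e i ≠ 0) :
    2 ≤ ∑ i ∈ I, e i ^ 2 + (∑ i ∈ I, b i * e i) ^ 2 := by
  obtain ⟨i, hi, hei⟩ := he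
  have one_le : ∀ x : ℤ, x ≠ 0 → 1 ≤ x ^ 2 := fun x hx => by
    have := pow_pos (abs_pos.2 hx) 2
    rw [sq_abs] at this
    omega
  rw [← Finset.add_sum_erase I (fun i => e i ^ 2) hi]
  by_cases h : ∃ k ∈ I.erase i, e k ≠ 0
  · obtain ⟨k, hk, hek⟩ := h
    have := Finset.single_le_sum (f := fun i => e i ^ 2) (fun i _ => sq_nonneg (e i)) hk
    linarith [one_le _ hei, one_le _ hek, sq_nonneg (∑ i ∈ I, b i * e i)]
  · push Not at h
    have pairing : ∑ k ∈ I, b k * e k = b i * e i :=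
      Finset.sum_eq_single_of_mem i hi fun k hk hki => by
        rw [h k (Finset.mem_erase.2 ⟨hki, hk⟩), mul_zero]
    rw [pairing]
    have := Finset.sum_nonneg (s := I.erase i) fun k _ => sq_nonneg (e k)
    linarith [one_le _ hei, one_le _ (mul_ne_zero (hb i hi).ne' hei)]


/-- For every `δ` with each `δ_s ∈ {−1, 0, 1}` and `δ ≠ 0`, the squared
Euclidean norm of `y = ∑ δ_s·A*_s` satisfies `‖y‖² ≥ 2/R²`. -/
theorem dual_norm_lower_bound
    (n : ℕ) (hn : 1 ≤ n)
    (a : ℕ → ℕ) (ha1 : a 1 = 0)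
    (hapos : ∀ i, 2 ≤ i → i ≤ n + 1 → 0 < a i)
    (R : ℝ) (hR : 0 < R)
    (S : ℝ) (hS : S = 1 + ∑ i ∈ Finset.Icc 2 (n + 1), (a i : ℝ) ^ 2)
    (X : ℕ → ℝ) (hX : ∀ s, X s = ∑ i ∈ Finset.Icc (n + 2 - s) (n + 1), (a i : ℝ))
    (N : ℕ → ℝ) (hN : ∀ s, 1 ≤ s → s ≤ n → N s = (a (n + 1 - s) : ℝ) - (a (n + 2 - s) : ℝ))
    (A : ℕ → Fin (n + 1) → ℝ)
    (hA : ∀ s, 1 ≤ s → s ≤ n → ∀ j : Fin (n + 1),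
      A s j =
        if (j : ℕ) + 1 = 1 then R / S * (-X s)
        else if (j : ℕ) + 1 ≤ n + 1 - s then R / S * (-(a ((j : ℕ) + 1) : ℝ) * X s)
        else R / S * (S - (a ((j : ℕ) + 1) : ℝ) * X s))
    (B : ℕ → ℕ → ℝ)
    (hB : ∀ s t, 1 ≤ s → s ≤ n → 1 ≤ t → t ≤ n → B s t =
      if s = t then (if s = n then 1 + N n ^ 2 else 2 + N s ^ 2)
      else if t = s + 1 ∨ s = t + 1 then -1 + N s * N t
      else N s * N t)
    (Astar : ℕ → Fin (n + 1) → ℝ)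
    (hAstar : ∀ s, 1 ≤ s → s ≤ n →
      Astar s = (R ^ 2)⁻¹ • ∑ t ∈ Finset.Icc 1 n, B s t • A t) :
    ∀ δ : ℕ → ℝ, (∀ s, 1 ≤ s → s ≤ n → δ s = -1 ∨ δ s = 0 ∨ δ s = 1) →
      (∃ s, 1 ≤ s ∧ s ≤ n ∧ δ s ≠ 0) →
      2 / R ^ 2 ≤ ∑ j : Fin (n + 1), ((∑ s ∈ Finset.Icc 1 n, δ s • Astar s) j) ^ 2 := by
  intro δ hδ hne
  set b : ℕ → ℝ := fun t => (a (n + 1 - t) : ℝ) with hb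
  have hbn : b n = 0 := by simp [hb, ha1]
  have sum_b_sq : ∑ t ∈ range n, b t ^ 2 = S - 1 := by
    rw [hS, add_sub_cancel_left, ← Finset.sum_range_reflect]
    rw [← Finset.Ico_add_one_right_eq_Icc, Finset.sum_Ico_eq_sum_range]
    refine Finset.sum_congr (by congr 1) fun t ht => ?_
    have := Finset.mem_range.1 ht
    simp only [hb]
    congr 3
    omega
  have hS0 : S ≠ 0 := by
    rw [hS]
    positivity
  have hR0 : R ≠ 0 := hR.ne'
  have X_zero : X 0 = 0 := by simp [hX]
  have X_succ : ∀ t ≤ n, X (t + 1) = X t + b t := by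
    intro t ht
    rw [hX, hX, show n + 2 - (t + 1) = n + 1 - t by omega,
      ← Finset.Ico_add_one_right_eq_Icc, ← Finset.Ico_add_one_right_eq_Icc,
      Finset.sum_eq_sum_Ico_succ_bot (by omega), add_comm, show n + 1 - t + 1 = n + 2 - t by omega]
  set v : ℕ → ℝ := fun j => if j = 0 then 1 else (a (j + 1) : ℝ) with hv
  -- `G j t` extends the coordinate `A t j` to `0 ≤ t ≤ n + 1`.
  set G : ℕ → ℕ → ℝ := fun j t =>
    R / S * (S * (if 1 ≤ j ∧ n + 1 ≤ j + t then 1 else 0) - v j * X t) with hG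
  have A_eq : ∀ t < n, ∀ j : Fin (n + 1), A (t + 1) j = G j (t + 1) := by
    intro t ht j
    rw [hA _ (by omega) (by omega)]
    simp only [hG, hv]
    split_ifs <;> first | omega | ring
  have G_zero : ∀ j ≤ n, G j 0 = 0 := by
    intro j hj
    simp only [hG, X_zero]
    rw [if_neg (by omega)]
    ring
  have G_step : ∀ j ≤ n, ∀ t ≤ n, G j (t + 1) - G j t
      = R / S * (S * (if 1 ≤ j ∧ j + t = n then 1 else 0) - v j * b t) := by
    intro j hj t ht
    simp only [hG, X_succ t ht]
    split_ifs <;> first | omega | ring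
  have G_last : ∀ j ≤ n, G j (n + 1) = G j n := by
    intro j hj
    have := G_step j hj n le_rfl
    rw [if_neg (by omega), hbn] at this
    linarith
  have sum_N_mul_G : ∀ j ≤ n, ∑ t ∈ range n, (b (t + 1) - b t) * G j (t + 1)
      = R / S * (v j * (S - 1) - if 1 ≤ j then S * v j else 0) := by
    intro j hj
    rw [sum_range_sub_mul_eq_neg b (G j) n hbn (G_zero j hj)]
    have term : ∀ t ∈ range n, b t * (G j (t + 1) - G j t)
        = (if n - j = t then (if 1 ≤ j then R * b t else 0) else 0) - R / S * v j * b t ^ 2 := by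
      intro t ht
      have := Finset.mem_range.1 ht
      rw [G_step j hj t this.le]
      split_ifs <;> first | omega | (field_simp; try ring)
    rw [Finset.sum_congr rfl term, Finset.sum_sub_distrib, ← Finset.mul_sum, sum_b_sq,
      Finset.sum_ite_eq]
    rcases Nat.eq_zero_or_pos j with rfl | hj0
    · simp
      ring
    · have : b (n - j) = v j := by
        simp only [hb, hv]
        rw [if_neg (by omega), show n + 1 - (n - j) = j + 1 by omega]
      rw [if_pos (Finset.mem_range.2 (by omega)), if_pos (show 1 ≤ j from hj0),
        if_pos (show 1 ≤ j from hj0), this]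
      field_simp
      ring
  have N_eq : ∀ s < n, N (s + 1) = b (s + 1) - b s := by
    intro s hs
    rw [hN _ (by omega) (by omega)]
    simp only [hb]
    rw [show n + 2 - (s + 1) = n + 1 - s by omega]
  have B_eq : ∀ s < n, ∀ t < n, B (s + 1) (t + 1)
      = (b (s + 1) - b s) * (b (t + 1) - b t) +
        (if s = t then (if s + 1 = n then (1 : ℝ) else 2)
          else if t = s + 1 ∨ s = t + 1 then -1 else 0) := by
    intro s hs t ht
    rw [hB _ _ (by omega) (by omega) (by omega) (by omega), ← N_eq s hs, ← N_eq t ht]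
    simp only [Nat.add_right_cancel_iff]
    split_ifs <;> first | omega | (subst_vars; ring)
  have Astar_eq : ∀ s < n, ∀ j : Fin (n + 1), Astar (s + 1) j
      = R⁻¹ * (if (j : ℕ) = 0 then b (s + 1) - b s
          else (if (j : ℕ) + s = n then 1 else 0) - (if (j : ℕ) + (s + 1) = n then 1 else 0)) := by
    intro s hs j
    have hj : (j : ℕ) ≤ n := by omega
    rw [hAstar _ (by omega) (by omega), sum_Icc_one_eq_sum_range]
    simp only [Pi.smul_apply, Finset.sum_apply, smul_eq_mul]
    have expand : ∑ t ∈ range n, B (s + 1) (t + 1) * A (t + 1) j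
        = (b (s + 1) - b s) * ∑ t ∈ range n, (b (t + 1) - b t) * G j (t + 1)
          + ((G j (s + 1) - G j s) - (G j (s + 2) - G j (s + 1))) := by
      rw [← sum_range_secondDifference (G j) n s hs (G_zero j hj) (G_last j hj), Finset.mul_sum,
        ← Finset.sum_add_distrib]
      refine Finset.sum_congr rfl fun t ht => ?_
      have := Finset.mem_range.1 ht
      rw [B_eq s hs t this, A_eq t this]
      ring
    rw [expand, sum_N_mul_G j hj, G_step j hj s hs.le, G_step j hj (s + 1) (by omega)]
    rcases Nat.eq_zero_or_pos (j : ℕ) with h | h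
    · simp [h, hv]
      field_simp
      ring
    · have h' : 1 ≤ (j : ℕ) := h
      simp only [h', h.ne', true_and, if_true, if_false]
      field_simp
      ring
  have lift : ∀ s, ∃ m : ℤ, (1 ≤ s ∧ s ≤ n → δ s = m) ∧ (s = 0 → m = 0) := by
    intro s
    by_cases h : 1 ≤ s ∧ s ≤ n
    · rcases hδ s h.1 h.2 with h' | h' | h'
      · exact ⟨-1, by simp [h'], by omega⟩
      · exact ⟨0, by simp [h'], by omega⟩
      · exact ⟨1, by simp [h'], by omega⟩
    · exact ⟨0, fun h' => absurd h' h, fun _ => rfl⟩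
  choose d hd hd0 using lift
  have d_zero : d 0 = 0 := hd0 0 rfl
  have y_eq : ∀ j : Fin (n + 1), (∑ s ∈ Finset.Icc 1 n, δ s • Astar s) j
      = R⁻¹ * ∑ s ∈ range n, (d (s + 1) : ℝ) * (if (j : ℕ) = 0 then b (s + 1) - b s
          else (if (j : ℕ) + s = n then 1 else 0)
            - (if (j : ℕ) + (s + 1) = n then 1 else 0)) := by
    intro j
    rw [sum_Icc_one_eq_sum_range, Finset.sum_apply, Finset.mul_sum]
    refine Finset.sum_congr rfl fun s hs => ?_
    have := Finset.mem_range.1 hs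
    rw [Pi.smul_apply, smul_eq_mul, Astar_eq s this, hd (s + 1) (by omega)]
    ring
  have y_zero : (∑ s ∈ Finset.Icc 1 n, δ s • Astar s) 0
      = R⁻¹ * -∑ t ∈ range n, b t * ((d (t + 1) : ℝ) - d t) := by
    rw [y_eq, ← sum_range_sub_mul_eq_neg b (fun t => (d t : ℝ)) n hbn (by simp [d_zero])]
    simp [mul_comm]
  have y_succ : ∀ k : Fin n, (∑ s ∈ Finset.Icc 1 n, δ s • Astar s) k.succ
      = R⁻¹ * ((d (n - 1 - k + 1) : ℝ) - d (n - 1 - k)) := by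
    intro k
    rw [y_eq]
    congr 1
    have hk := k.2
    have term : ∀ s ∈ range n, (d (s + 1) : ℝ) * (if (k.succ : ℕ) = 0 then b (s + 1) - b s
          else (if (k.succ : ℕ) + s = n then 1 else 0)
            - (if (k.succ : ℕ) + (s + 1) = n then 1 else 0))
        = (if n - 1 - k = s then (d (s + 1) : ℝ) else 0)
          - (if n - 1 - k = s + 1 then (d (s + 1) : ℝ) else 0) := by
      intro s hs
      have := Finset.mem_range.1 hs
      rw [Fin.val_succ, if_neg (by omega)]
      split_ifs <;> first | omega | ring
    rw [Finset.sum_congr rfl term, Finset.sum_sub_distrib, Finset.sum_ite_eq,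
      if_pos (Finset.mem_range.2 (by omega))]
    congr 1
    obtain h | ⟨m, hm⟩ : n - 1 - (k : ℕ) = 0 ∨ ∃ m, n - 1 - (k : ℕ) = m + 1 :=
      Nat.eq_zero_or_eq_succ_pred _ |>.imp_right fun h => ⟨_, h⟩
    · simp [h, d_zero]
    · simp only [hm, Nat.add_right_cancel_iff, Finset.sum_ite_eq, Finset.mem_range]
      rw [if_pos (by omega)]
  have sum_succ : ∑ k : Fin n, ((∑ s ∈ Finset.Icc 1 n, δ s • Astar s) k.succ) ^ 2
      = (R ^ 2)⁻¹ * ∑ t ∈ range n, ((d (t + 1) : ℝ) - d t) ^ 2 := by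
    rw [← Finset.sum_range_reflect, Finset.mul_sum,
      Finset.sum_range fun t => (R ^ 2)⁻¹ * ((d (n - 1 - t + 1) : ℝ) - d (n - 1 - t)) ^ 2]
    exact Finset.sum_congr rfl fun k _ => by rw [y_succ, mul_pow, inv_pow]
  have exists_step : ∃ t ∈ range n, d (t + 1) - d t ≠ 0 := by
    by_contra! h
    obtain ⟨s, hs1, hsn, hs⟩ := hne
    have zero : ∀ t ≤ n, d t = 0 := by
      intro t
      induction t with
      | zero => exact fun _ => d_zero
      | succ t ih =>
        intro ht
        have := h t (Finset.mem_range.2 (by omega))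
        have := ih (by omega)
        omega
    exact hs (by rw [hd s ⟨hs1, hsn⟩, zero s hsn, Int.cast_zero])
  have bound := two_le_sum_sq_add_sq_sum_mul (range n) (fun t => d (t + 1) - d t)
    (fun t => (a (n + 1 - t) : ℤ))
    (fun t ht => by
      have := Finset.mem_range.1 ht
      exact_mod_cast hapos _ (by omega) (by omega)) exists_step
  have bound' : (2 : ℝ) ≤ ∑ t ∈ range n, ((d (t + 1) : ℝ) - d t) ^ 2
      + (∑ t ∈ range n, b t * ((d (t + 1) : ℝ) - d t)) ^ 2 := by
    simp only [hb]
    exact_mod_cast bound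
  rw [Fin.sum_univ_succ, y_zero, sum_succ, mul_pow, neg_sq, inv_pow, ← mul_add, div_eq_inv_mul,
    add_comm]
  exact mul_le_mul_of_nonneg_left bound' (by positivity)
end

section
/- There exists a nonzero δ = (δ_1, …, δ_n) with each δ_s ∈ {−1, 0, 1} such that the squared Euclidean norm of ∑_{s=1}^{n} δ_s·A*_s equals exactly 2/R² if and only if at least two components of the (n+1)-tuple (1, a₂, …, a_{n+1}) are equal (i.e., some a_i = 1, or a_i = a_j for some 2 ≤ i < j ≤ n+1). -/
/-- Summation by parts for a sequence vanishing at `0`. -/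
lemma sum_Icc_forward_diff_mul (b f : ℕ → ℝ) (hf : f 0 = 0) (n : ℕ) :
    ∑ t ∈ Finset.Icc 1 n, (b (t + 1) - b t) * f t =
      b (n + 1) * f n - ∑ k ∈ Finset.range n, b (k + 1) * (f (k + 1) - f k) := by
  induction n with
  | zero => simp [hf]
  | succ n ih =>
    rw [Finset.sum_Icc_succ_top (by omega), ih, Finset.sum_range_succ]
    ring

/-- A path-graph Laplacian plus the rank-one matrix `N Nᵀ`, applied to a sequence extended by
`f 0 = 0` and `f (n + 1) = f n`. -/
lemma sum_laplacian_add_rankOne_mul (n : ℕ) (N f : ℕ → ℝ) (B : ℕ → ℕ → ℝ)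
    (hB : ∀ s t, 1 ≤ s → s ≤ n → 1 ≤ t → t ≤ n → B s t =
      if s = t then (if s = n then 1 + N n ^ 2 else 2 + N s ^ 2)
      else if t = s + 1 ∨ s = t + 1 then -1 + N s * N t
      else N s * N t)
    (hf0 : f 0 = 0) (hfn : f (n + 1) = f n) (s : ℕ) (hs1 : 1 ≤ s) (hsn : s ≤ n) :
    ∑ t ∈ Finset.Icc 1 n, B s t * f t =
      2 * f s - f (s - 1) - f (s + 1) + N s * ∑ t ∈ Finset.Icc 1 n, N t * f t := by
  have hpt : ∀ t ∈ Finset.Icc 1 n, B s t * f t =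
      (if s = t then (if s = n then 1 else 2) * f t else 0) - (if s - 1 = t then f t else 0)
        - (if s + 1 = t then f t else 0) + N s * (N t * f t) := by
    intro t ht
    rw [Finset.mem_Icc] at ht
    rw [hB s t hs1 hsn ht.1 ht.2]
    rcases lt_trichotomy s t with h | h | h
    · by_cases h' : s + 1 = t
      · subst h'
        simp [show s - 1 ≠ s + 1 by omega]
        ring
      · simp [h.ne, h', show t ≠ s + 1 by omega, show s ≠ t + 1 by omega,
          show s - 1 ≠ t by omega]
        ring
    · subst h
      simp only [if_true, show s - 1 ≠ s by omega, if_false, show s + 1 ≠ s by omega]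
      split_ifs with h
      · subst h
        ring
      · ring
    · by_cases h' : s = t + 1
      · subst h'
        simp [show t + 1 + 1 ≠ t by omega]
        ring
      · simp [h.ne', h', show t ≠ s + 1 by omega, show s + 1 ≠ t by omega,
          show s - 1 ≠ t by omega]
        ring
  rw [Finset.sum_congr rfl hpt, Finset.sum_add_distrib, Finset.sum_sub_distrib,
    Finset.sum_sub_distrib, ← Finset.mul_sum]
  simp only [Finset.sum_ite_eq, Finset.mem_Icc]
  rw [if_pos ⟨hs1, hsn⟩]
  have hpred : (if 1 ≤ s - 1 ∧ s - 1 ≤ n then f (s - 1) else 0) = f (s - 1) := by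
    split_ifs with h
    · rfl
    · rw [show s - 1 = 0 by omega, hf0]
  rw [hpred]
  by_cases h : s = n
  · subst h
    simp [hfn]
    ring
  · rw [if_neg h, if_pos ⟨by omega, by omega⟩]

lemma exists_unique_ne_zero_of_sum_sq_eq_one {ι : Type*} [DecidableEq ι] (s : Finset ι)
    (d : ι → ℤ) (h : ∑ k ∈ s, d k ^ 2 = 1) :
    ∃ k ∈ s, (d k = 1 ∨ d k = -1) ∧ ∀ l ∈ s, l ≠ k → d l = 0 := by
  obtain ⟨k, hk, hne⟩ := Finset.exists_ne_zero_of_sum_ne_zero (by rw [h]; exact one_ne_zero)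
  have herase := Finset.add_sum_erase s (fun k => d k ^ 2) hk
  have hnn : 0 ≤ ∑ l ∈ s.erase k, d l ^ 2 := Finset.sum_nonneg fun _ _ => sq_nonneg _
  have hpos : 0 < d k ^ 2 := lt_of_le_of_ne (sq_nonneg _) (Ne.symm hne)
  simp only [h] at herase
  have hzero : ∑ l ∈ s.erase k, d l ^ 2 = 0 := by omega
  rw [Finset.sum_eq_zero_iff_of_nonneg fun _ _ => sq_nonneg _] at hzero
  refine ⟨k, hk, sq_eq_one_iff.mp (by omega), fun l hl hlk => ?_⟩
  exact pow_eq_zero_iff two_ne_zero |>.mp (hzero l (Finset.mem_erase.mpr ⟨hlk, hl⟩))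

lemma exists_pair_ne_zero_of_sum_sq_eq_two {ι : Type*} [DecidableEq ι] (s : Finset ι)
    (d : ι → ℤ) (h : ∑ k ∈ s, d k ^ 2 = 2) :
    ∃ k ∈ s, ∃ l ∈ s, k ≠ l ∧ (d k = 1 ∨ d k = -1) ∧ (d l = 1 ∨ d l = -1) ∧
      ∀ i ∈ s, i ≠ k → i ≠ l → d i = 0 := by
  obtain ⟨k, hk, hne⟩ := Finset.exists_ne_zero_of_sum_ne_zero (by rw [h]; exact two_ne_zero)
  have herase := Finset.add_sum_erase s (fun k => d k ^ 2) hk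
  have hnn : 0 ≤ ∑ l ∈ s.erase k, d l ^ 2 := Finset.sum_nonneg fun _ _ => sq_nonneg _
  simp only [h] at herase
  have hk1 : d k = 1 ∨ d k = -1 := by
    have hlt : d k < 2 := by nlinarith
    have hgt : -2 < d k := by nlinarith
    have h0 : d k ≠ 0 := fun h0 => hne (by simp [h0])
    omega
  have hsq : d k ^ 2 = 1 := by rcases hk1 with h | h <;> simp [h]
  obtain ⟨l, hl, hl1, hrest⟩ :=
    exists_unique_ne_zero_of_sum_sq_eq_one (s.erase k) d (by omega)
  rw [Finset.mem_erase] at hl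
  exact ⟨k, hk, l, hl.2, hl.1.symm, hk1, hl1,
    fun i hi hik hil => hrest i (Finset.mem_erase.mpr ⟨hik, hi⟩) hil⟩

/-- An integer vector of squared norm `2` orthogonal to `(1, c)`, with `c` positive, forces two
entries of `(1, c)` to agree. -/
lemma exists_eq_of_sq_sum_mul_add_sum_sq_eq_two {ι : Type*} [DecidableEq ι] (s : Finset ι)
    (d : ι → ℤ) (c : ι → ℕ) (hc : ∀ k ∈ s, 0 < c k)
    (h : (∑ k ∈ s, d k * c k) ^ 2 + ∑ k ∈ s, d k ^ 2 = 2) :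
    (∃ k ∈ s, c k = 1) ∨ ∃ k ∈ s, ∃ l ∈ s, k ≠ l ∧ c k = c l := by
  have hnn : 0 ≤ ∑ l ∈ s, d l ^ 2 := Finset.sum_nonneg fun _ _ => sq_nonneg _
  have hlt : ∑ k ∈ s, d k * c k < 2 := by nlinarith
  have hgt : -2 < ∑ k ∈ s, d k * c k := by nlinarith
  by_cases h0 : ∑ k ∈ s, d k * (c k : ℤ) = 0
  · right
    rw [h0] at h
    obtain ⟨k, hk, l, hl, hkl, hk1, hl1, hrest⟩ :=
      exists_pair_ne_zero_of_sum_sq_eq_two s d (by simpa using h)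
    refine ⟨k, hk, l, hl, hkl, ?_⟩
    rw [Finset.sum_eq_add_of_mem k l hk hl hkl
      fun i hi hik => by rw [hrest i hi hik.1 hik.2, zero_mul]] at h0
    have hck := hc k hk
    have hcl := hc l hl
    rcases hk1 with e | e <;> rcases hl1 with e' | e' <;> rw [e, e'] at h0 <;> omega
  · left
    have hone : ∑ k ∈ s, d k * (c k : ℤ) = 1 ∨ ∑ k ∈ s, d k * (c k : ℤ) = -1 := by omega
    have hsq : (∑ k ∈ s, d k * (c k : ℤ)) ^ 2 = 1 := by rcases hone with e | e <;> simp [e]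
    obtain ⟨k, hk, hk1, hrest⟩ := exists_unique_ne_zero_of_sum_sq_eq_one s d (by omega)
    refine ⟨k, hk, ?_⟩
    rw [Finset.sum_eq_single_of_mem k hk
      fun i hi hik => by rw [hrest i hi hik, zero_mul]] at hone
    rcases hk1 with e | e <;> rw [e] at hone <;> omega

/-- There exists a nonzero `δ` with each `δ_s ∈ {−1, 0, 1}` such that the
squared Euclidean norm of `∑ δ_s·A*_s` equals exactly `2/R²` if and only if at least two
components of the `(n+1)`-tuple `(1, a₂, …, a_{n+1})` are equal. -/
theorem dual_norm_equality_case
    (n : ℕ) (hn : 1 ≤ n)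
    (a : ℕ → ℕ) (ha1 : a 1 = 0)
    (hapos : ∀ i, 2 ≤ i → i ≤ n + 1 → 0 < a i)
    (R : ℝ) (hR : 0 < R)
    (S : ℝ) (hS : S = 1 + ∑ i ∈ Finset.Icc 2 (n + 1), (a i : ℝ) ^ 2)
    (X : ℕ → ℝ) (hX : ∀ s, X s = ∑ i ∈ Finset.Icc (n + 2 - s) (n + 1), (a i : ℝ))
    (N : ℕ → ℝ) (hN : ∀ s, 1 ≤ s → s ≤ n → N s = (a (n + 1 - s) : ℝ) - (a (n + 2 - s) : ℝ))
    (A : ℕ → Fin (n + 1) → ℝ)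
    (hA : ∀ s, 1 ≤ s → s ≤ n → ∀ j : Fin (n + 1),
      A s j =
        if (j : ℕ) + 1 = 1 then R / S * (-X s)
        else if (j : ℕ) + 1 ≤ n + 1 - s then R / S * (-(a ((j : ℕ) + 1) : ℝ) * X s)
        else R / S * (S - (a ((j : ℕ) + 1) : ℝ) * X s))
    (B : ℕ → ℕ → ℝ)
    (hB : ∀ s t, 1 ≤ s → s ≤ n → 1 ≤ t → t ≤ n → B s t =
      if s = t then (if s = n then 1 + N n ^ 2 else 2 + N s ^ 2)
      else if t = s + 1 ∨ s = t + 1 then -1 + N s * N t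
      else N s * N t)
    (Astar : ℕ → Fin (n + 1) → ℝ)
    (hAstar : ∀ s, 1 ≤ s → s ≤ n →
      Astar s = (R ^ 2)⁻¹ • ∑ t ∈ Finset.Icc 1 n, B s t • A t) :
    (∃ δ : ℕ → ℝ, (∀ s, 1 ≤ s → s ≤ n → δ s = -1 ∨ δ s = 0 ∨ δ s = 1) ∧
        (∃ s, 1 ≤ s ∧ s ≤ n ∧ δ s ≠ 0) ∧
        ∑ j : Fin (n + 1), ((∑ s ∈ Finset.Icc 1 n, δ s • Astar s) j) ^ 2 = 2 / R ^ 2) ↔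
      ((∃ i, 2 ≤ i ∧ i ≤ n + 1 ∧ a i = 1) ∨
        (∃ i j, 2 ≤ i ∧ i < j ∧ j ≤ n + 1 ∧ a i = a j)) := by
  have hSpos : 0 < S := by
    rw [hS]
    have : 0 ≤ ∑ i ∈ Finset.Icc 2 (n + 1), (a i : ℝ) ^ 2 := Finset.sum_nonneg fun _ _ => sq_nonneg _
    linarith
  have hX0 : X 0 = 0 := by simp [hX]
  have hXsucc : ∀ k ≤ n, X (k + 1) - X k = a (n + 1 - k) := by
    intro k hk
    rw [hX, hX, show n + 2 - (k + 1) = n + 1 - k by omega,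
      ← Finset.add_sum_Ioc_eq_sum_Icc (by omega : n + 1 - k ≤ n + 1),
      show Finset.Icc (n + 2 - k) (n + 1) = Finset.Ioc (n + 1 - k) (n + 1) by
        ext; simp only [Finset.mem_Icc, Finset.mem_Ioc]; omega]
    ring
  have hXn : X (n + 1) = X n := by
    have := hXsucc n le_rfl
    rw [show n + 1 - n = 1 by omega, ha1] at this
    push_cast at this
    linarith
  have habel : ∀ f : ℕ → ℝ, f 0 = 0 → ∑ t ∈ Finset.Icc 1 n, N t * f t =
      -∑ k ∈ Finset.range n, (a (n + 1 - k) : ℝ) * (f (k + 1) - f k) := by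
    intro f hf
    have h := sum_Icc_forward_diff_mul (fun t => (a (n + 2 - t) : ℝ)) f hf n
    simp only [show n + 2 - (n + 1) = 1 by omega, ha1, Nat.cast_zero, zero_mul, zero_sub] at h
    simp only [show ∀ k, n + 2 - (k + 1) = n + 1 - k by omega] at h
    rw [← h]
    refine Finset.sum_congr rfl fun t ht => ?_
    rw [Finset.mem_Icc] at ht
    rw [hN t ht.1 ht.2]
  have hNX : ∑ t ∈ Finset.Icc 1 n, N t * X t = -(S - 1) := by
    rw [habel X hX0, hS, add_sub_cancel_left]
    congr 1
    refine Finset.sum_bij' (fun k _ => n + 1 - k) (fun i _ => n + 1 - i) ?_ ?_ ?_ ?_ ?_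
    · intro k hk; rw [Finset.mem_range] at hk; rw [Finset.mem_Icc]; omega
    · intro k hk; rw [Finset.mem_Icc] at hk; rw [Finset.mem_range]; omega
    · intro k hk; rw [Finset.mem_range] at hk; omega
    · intro k hk; rw [Finset.mem_Icc] at hk; omega
    · intro k hk
      rw [Finset.mem_range] at hk
      rw [hXsucc k (by omega)]
      ring
  have hBX : ∀ s, 1 ≤ s → s ≤ n → ∑ t ∈ Finset.Icc 1 n, B s t * X t = -S * N s := by
    intro s hs1 hsn
    rw [sum_laplacian_add_rankOne_mul n N X B hB hX0 hXn s hs1 hsn, hNX, hN s hs1 hsn]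
    have h1 := hXsucc s hsn
    have h2 := hXsucc (s - 1) (by omega)
    rw [show s - 1 + 1 = s by omega, show n + 1 - (s - 1) = n + 2 - s by omega] at h2
    linear_combination h2 - h1
  have hAstar_zero : ∀ s, 1 ≤ s → s ≤ n → Astar s 0 = R⁻¹ * N s := by
    intro s hs1 hsn
    rw [hAstar s hs1 hsn]
    simp only [Pi.smul_apply, Finset.sum_apply, smul_eq_mul]
    have h : ∑ t ∈ Finset.Icc 1 n, B s t * A t 0 =
        -(R / S) * ∑ t ∈ Finset.Icc 1 n, B s t * X t := by
      rw [Finset.mul_sum]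
      refine Finset.sum_congr rfl fun t ht => ?_
      rw [Finset.mem_Icc] at ht
      rw [hA t ht.1 ht.2, if_pos (by simp)]
      ring
    rw [h, hBX s hs1 hsn]
    field_simp
  have hAstar_succ : ∀ s, 1 ≤ s → s ≤ n → ∀ i : Fin n, Astar s i.succ =
      R⁻¹ * ((if n - i = s then 1 else 0) - (if n - i - 1 = s then 1 else 0)) := by
    intro s hs1 hsn i
    have hi := i.isLt
    set E : ℕ → ℝ := fun t => if n ≤ i + t then 1 else 0 with hE
    have hE0 : E 0 = 0 := by simp [hE]
    have hEn : E (n + 1) = E n := by simp [hE, show n ≤ i + (n + 1) by omega]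
    have hEsucc : ∀ k, E (k + 1) - E k = if n - i - 1 = k then 1 else 0 := by
      intro k
      simp only [hE]
      split_ifs <;> first | omega | norm_num
    have hNE : ∑ t ∈ Finset.Icc 1 n, N t * E t = -(a (i + 2) : ℝ) := by
      rw [habel E hE0]
      simp only [hEsucc, mul_ite, mul_one, mul_zero, Finset.sum_ite_eq, Finset.mem_range]
      rw [if_pos (by omega), show n + 1 - (n - i - 1) = i + 2 by omega]
    rw [hAstar s hs1 hsn]
    simp only [Pi.smul_apply, Finset.sum_apply, smul_eq_mul]
    have h : ∑ t ∈ Finset.Icc 1 n, B s t * A t i.succ =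
        R * ∑ t ∈ Finset.Icc 1 n, B s t * E t -
          R / S * a (i + 2) * ∑ t ∈ Finset.Icc 1 n, B s t * X t := by
      rw [Finset.mul_sum, Finset.mul_sum, ← Finset.sum_sub_distrib]
      refine Finset.sum_congr rfl fun t ht => ?_
      rw [Finset.mem_Icc] at ht
      rw [hA t ht.1 ht.2, if_neg (by simp), Fin.val_succ]
      simp only [hE]
      by_cases hit : n ≤ i + t
      · rw [if_neg (by omega), if_pos hit]
        field_simp
      · rw [if_pos (by omega), if_neg hit]
        ring
    have h1 := hEsucc s
    have h2 := hEsucc (s - 1)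
    rw [show s - 1 + 1 = s by omega] at h2
    have hshift : (if n - i - 1 = s - 1 then (1 : ℝ) else 0) = if n - i = s then 1 else 0 := by
      congr 1
      apply propext
      omega
    rw [hshift] at h2
    rw [h, hBX s hs1 hsn, sum_laplacian_add_rankOne_mul n N E B hB hE0 hEn s hs1 hsn, hNE,
      ← h1, ← h2]
    field_simp
    ring
  have hnorm : ∀ δ : ℕ → ℝ, δ 0 = 0 →
      ∑ j : Fin (n + 1), ((∑ s ∈ Finset.Icc 1 n, δ s • Astar s) j) ^ 2 =
        ((∑ k ∈ Finset.range n, (δ (k + 1) - δ k) * (a (n + 1 - k) : ℝ)) ^ 2 +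
          ∑ k ∈ Finset.range n, (δ (k + 1) - δ k) ^ 2) / R ^ 2 := by
    intro δ hδ
    have h0 : (∑ s ∈ Finset.Icc 1 n, δ s • Astar s) 0 =
        -R⁻¹ * ∑ k ∈ Finset.range n, (δ (k + 1) - δ k) * (a (n + 1 - k) : ℝ) := by
      have h := habel δ hδ
      rw [Finset.sum_congr rfl fun k _ => mul_comm (δ (k + 1) - δ k) (a (n + 1 - k) : ℝ),
        neg_mul, ← mul_neg, ← h, Finset.mul_sum]
      simp only [Pi.smul_apply, Finset.sum_apply, smul_eq_mul]
      refine Finset.sum_congr rfl fun s hs => ?_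
      rw [Finset.mem_Icc] at hs
      rw [hAstar_zero s hs.1 hs.2]
      ring
    have hsucc : ∀ i : Fin n, (∑ s ∈ Finset.Icc 1 n, δ s • Astar s) i.succ =
        R⁻¹ * (δ (n - 1 - i + 1) - δ (n - 1 - i)) := by
      intro i
      have hi := i.isLt
      have hpt : ∀ s ∈ Finset.Icc 1 n, δ s * Astar s i.succ =
          R⁻¹ * ((if n - i = s then δ s else 0) - (if n - i - 1 = s then δ s else 0)) := by
        intro s hs
        rw [Finset.mem_Icc] at hs
        rw [hAstar_succ s hs.1 hs.2]
        split_ifs <;> ring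
      simp only [Pi.smul_apply, Finset.sum_apply, smul_eq_mul]
      rw [Finset.sum_congr rfl hpt, ← Finset.mul_sum, Finset.sum_sub_distrib]
      simp only [Finset.sum_ite_eq, Finset.mem_Icc]
      rw [if_pos ⟨by omega, by omega⟩, show n - 1 - i + 1 = n - i by omega,
        show n - 1 - (i : ℕ) = n - i - 1 by omega]
      congr 2
      split_ifs with h
      · rfl
      · rw [show n - (i : ℕ) - 1 = 0 by omega, hδ]
    rw [Fin.sum_univ_succ, h0]
    simp only [hsucc, mul_pow]
    rw [← Finset.mul_sum, Fin.sum_univ_eq_sum_range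
      (fun i => (δ (n - 1 - i + 1) - δ (n - 1 - i)) ^ 2) n,
      Finset.sum_range_reflect (fun i => (δ (i + 1) - δ i) ^ 2) n]
    field_simp
  have hR2 : R ^ 2 ≠ 0 := by positivity
  constructor
  · rintro ⟨δ, hδ, -, hsum⟩
    have hex : ∀ s, ∃ e : ℤ, (s = 0 → e = 0) ∧ (1 ≤ s → s ≤ n → (e : ℝ) = δ s) := by
      intro s
      by_cases hs : 1 ≤ s ∧ s ≤ n
      · rcases hδ s hs.1 hs.2 with h | h | h
        · exact ⟨-1, by omega, fun _ _ => by simp [h]⟩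
        · exact ⟨0, by omega, fun _ _ => by simp [h]⟩
        · exact ⟨1, by omega, fun _ _ => by simp [h]⟩
      · exact ⟨0, fun _ => rfl, fun h1 h2 => absurd ⟨h1, h2⟩ hs⟩
    choose e he0 he using hex
    have hcongr : ∑ s ∈ Finset.Icc 1 n, δ s • Astar s =
        ∑ s ∈ Finset.Icc 1 n, (e s : ℝ) • Astar s := by
      refine Finset.sum_congr rfl fun s hs => ?_
      rw [Finset.mem_Icc] at hs
      rw [he s hs.1 hs.2]
    rw [hcongr, hnorm (fun s => (e s : ℝ)) (by simp [he0 0 rfl]),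
      div_left_inj' hR2] at hsum
    rcases exists_eq_of_sq_sum_mul_add_sum_sq_eq_two (Finset.range n)
      (fun k => e (k + 1) - e k) (fun k => a (n + 1 - k))
      (fun k hk => by rw [Finset.mem_range] at hk; exact hapos _ (by omega) (by omega))
      (by exact_mod_cast hsum) with ⟨k, hk, hak⟩ | ⟨k, hk, l, hl, hkl, hakl⟩
    · rw [Finset.mem_range] at hk
      exact Or.inl ⟨n + 1 - k, by omega, by omega, hak⟩
    · rw [Finset.mem_range] at hk hl
      rcases lt_or_gt_of_ne hkl with h | h
      · exact Or.inr ⟨n + 1 - l, n + 1 - k, by omega, by omega, by omega, hakl.symm⟩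
      · exact Or.inr ⟨n + 1 - k, n + 1 - l, by omega, by omega, by omega, hakl⟩
  · rintro (⟨i, hi2, hin, hai⟩ | ⟨i, j, hi2, hij, hjn, haij⟩)
    · refine ⟨fun s => if n + 2 ≤ s + i then 1 else 0, fun s _ _ => ?_,
        ⟨n, hn, le_rfl, by simp [show n + 2 ≤ n + i by omega]⟩, ?_⟩
      · dsimp only
        split_ifs <;> simp
      · rw [hnorm _ (by simp; omega)]
        have hd : ∀ k : ℕ, (if n + 2 ≤ k + 1 + i then (1 : ℝ) else 0) -
            (if n + 2 ≤ k + i then 1 else 0) = if n + 1 - i = k then 1 else 0 := by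
          intro k
          split_ifs <;> first | omega | norm_num
        simp only [hd, ite_pow, one_pow, ite_mul, one_mul, zero_mul, Finset.sum_ite_eq,
          Finset.mem_range, show n + 1 - i < n by omega, if_true,
          show n + 1 - (n + 1 - i) = i by omega, hai, ne_eq, OfNat.ofNat_ne_zero,
          not_false_eq_true, zero_pow]
        norm_num
    · refine ⟨fun s => if n + 2 ≤ s + j ∧ s + i < n + 2 then 1 else 0, fun s _ _ => ?_,
        ⟨n + 2 - j, by omega, by omega, ?_⟩, ?_⟩
      · dsimp only
        split_ifs <;> simp
      · dsimp only
        rw [if_pos ⟨by omega, by omega⟩]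
        exact one_ne_zero
      · rw [hnorm _ (if_neg (by omega))]
        have hd : ∀ k : ℕ, (if n + 2 ≤ k + 1 + j ∧ k + 1 + i < n + 2 then (1 : ℝ) else 0) -
            (if n + 2 ≤ k + j ∧ k + i < n + 2 then 1 else 0) =
              (if n + 1 - j = k then 1 else 0) - if n + 1 - i = k then 1 else 0 := by
          intro k
          split_ifs <;> first | omega | norm_num
        have hsq : ∀ k : ℕ, ((if n + 1 - j = k then (1 : ℝ) else 0) -
            if n + 1 - i = k then 1 else 0) ^ 2 =
              (if n + 1 - j = k then 1 else 0) + if n + 1 - i = k then 1 else 0 := by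
          intro k
          split_ifs <;> first | omega | norm_num
        simp only [hd, hsq, sub_mul, ite_mul, one_mul, zero_mul, Finset.sum_sub_distrib,
          Finset.sum_add_distrib, Finset.sum_ite_eq, Finset.mem_range,
          show n + 1 - i < n by omega, show n + 1 - j < n by omega, if_true,
          show n + 1 - (n + 1 - i) = i by omega, show n + 1 - (n + 1 - j) = j by omega, haij]
        norm_num
end
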